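/- arXiv:2412.00669 — 8 statements merged into one kernel-verified Lean document; each statement's English description precedes it below -/
import Mathlib

section
/- Let (R, m, k) be a commutative noetherian local ring and let I and J be nonzero ideals of R such that m = I ⊕ J (internal direct sum of R-modules). Then the ideal I is a direct summand of the first syzygy Ω_R(J) of J in a minimal free resolution, and J is a direct summand of Ω_R(I). -/
universe u

/-- A minimal free resolution of the module `M` over `R`, where minimality is
measured with respect to the ideal `𝔪` (the maximal ideal in applications). -/
structure MinFreeRes (R : Type u) [CommRing R] (𝔪 : Ideal R)
    (M : Type u) [AddCommGroup M] [Module R M] : Type u where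
  b : ℕ → ℕ
  aug : (Fin (b 0) → R) →ₗ[R] M
  d : ∀ n : ℕ, (Fin (b (n + 1)) → R) →ₗ[R] (Fin (b n) → R)
  aug_surj : Function.Surjective aug
  exact_aug : LinearMap.range (d 0) = LinearMap.ker aug
  exact : ∀ n, LinearMap.range (d (n + 1)) = LinearMap.ker (d n)
  minimal : ∀ n, LinearMap.range (d n) ≤ 𝔪 • (⊤ : Submodule R (Fin (b n) → R))

namespace MinFreeRes

variable {R : Type u} [CommRing R] {𝔪 : Ideal R}
  {M : Type u} [AddCommGroup M] [Module R M]

/-- The `n`-th syzygy of `M` given by the minimal free resolution `F`: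
`Syz 0 = M` and `Syz (n+1) = image of d n = ker of the previous map`. -/
def Syz (F : MinFreeRes R 𝔪 M) : ℕ → Type u
  | 0 => M
  | n + 1 => ↥(LinearMap.range (F.d n))

instance (F : MinFreeRes R 𝔪 M) : ∀ n, AddCommGroup (F.Syz n)
  | 0 => inferInstanceAs (AddCommGroup M)
  | n + 1 => inferInstanceAs (AddCommGroup ↥(LinearMap.range (F.d n)))

instance (F : MinFreeRes R 𝔪 M) : ∀ n, Module R (F.Syz n)
  | 0 => inferInstanceAs (Module R M)
  | n + 1 => inferInstanceAs (Module R ↥(LinearMap.range (F.d n)))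

/-- The Auslander transpose of `M` computed from the minimal free resolution `F`:
the cokernel of the `R`-dual of the first differential. -/
def Tr (F : MinFreeRes R 𝔪 M) : Type u :=
  (Module.Dual R (Fin (F.b 1) → R)) ⧸ LinearMap.range ((F.d 0).dualMap)

instance (F : MinFreeRes R 𝔪 M) : AddCommGroup F.Tr :=
  inferInstanceAs (AddCommGroup
    ((Module.Dual R (Fin (F.b 1) → R)) ⧸ LinearMap.range ((F.d 0).dualMap)))

instance (F : MinFreeRes R 𝔪 M) : Module R F.Tr :=
  inferInstanceAs (Module R
    ((Module.Dual R (Fin (F.b 1) → R)) ⧸ LinearMap.range ((F.d 0).dualMap)))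

/-- `Ext¹_R(M, N)` computed from the minimal free resolution `F` of `M`:
the homology of `Hom(F₀,N) → Hom(F₁,N) → Hom(F₂,N)` in the middle spot. -/
def Ext1 (F : MinFreeRes R 𝔪 M) (N : Type u) [AddCommGroup N] [Module R N] : Type u :=
  ↥(LinearMap.ker (LinearMap.lcomp R N (F.d 1))) ⧸
    (LinearMap.range (LinearMap.lcomp R N (F.d 0))).comap
      (LinearMap.ker (LinearMap.lcomp R N (F.d 1))).subtype

instance (F : MinFreeRes R 𝔪 M) (N : Type u) [AddCommGroup N] [Module R N] :
    AddCommGroup (F.Ext1 N) :=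
  inferInstanceAs (AddCommGroup
    (↥(LinearMap.ker (LinearMap.lcomp R N (F.d 1))) ⧸
      (LinearMap.range (LinearMap.lcomp R N (F.d 0))).comap
        (LinearMap.ker (LinearMap.lcomp R N (F.d 1))).subtype))

instance (F : MinFreeRes R 𝔪 M) (N : Type u) [AddCommGroup N] [Module R N] :
    Module R (F.Ext1 N) :=
  inferInstanceAs (Module R
    (↥(LinearMap.ker (LinearMap.lcomp R N (F.d 1))) ⧸
      (LinearMap.range (LinearMap.lcomp R N (F.d 0))).comap
        (LinearMap.ker (LinearMap.lcomp R N (F.d 1))).subtype))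

end MinFreeRes

/-- `S` is (isomorphic to) a direct summand of `M` as an `R`-module. -/
def IsDirectSummand (R : Type u) [CommRing R] (S M : Type u)
    [AddCommGroup S] [Module R S] [AddCommGroup M] [Module R M] : Prop :=
  ∃ (i : S →ₗ[R] M) (p : M →ₗ[R] S), p ∘ₗ i = LinearMap.id

/-- `S` belongs to `add X`: it is a direct summand of a finite direct sum of copies of `X`. -/
def InAddClosure (R : Type u) [CommRing R] (S X : Type u)
    [AddCommGroup S] [Module R S] [AddCommGroup X] [Module R X] : Prop :=
  ∃ r : ℕ, IsDirectSummand R S (Fin r → X)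

/-- There exists a short exact sequence `0 → A → B → C → 0` of `R`-modules. -/
def ExistsSES (R : Type u) [CommRing R] (A B C : Type u)
    [AddCommGroup A] [Module R A] [AddCommGroup B] [Module R B]
    [AddCommGroup C] [Module R C] : Prop :=
  ∃ (i : A →ₗ[R] B) (p : B →ₗ[R] C),
    Function.Injective i ∧ Function.Surjective p ∧ LinearMap.range i = LinearMap.ker p

/-- The `R`-module `M` has depth (with respect to the ideal `𝔪`) equal to `t`:
there is an `M`-regular sequence of length `t` in `𝔪` and no longer one. -/
def HasDepth (R : Type u) [CommRing R] (𝔪 : Ideal R) (M : Type u)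
    [AddCommGroup M] [Module R M] (t : ℕ) : Prop :=
  (∃ rs : List R, rs.length = t ∧ (∀ x ∈ rs, x ∈ 𝔪) ∧ RingTheory.Sequence.IsRegular M rs) ∧
  ∀ rs : List R, (∀ x ∈ rs, x ∈ 𝔪) → RingTheory.Sequence.IsRegular M rs → rs.length ≤ t

/-- `𝔪` needs at least (and exactly) `e` generators. -/
def HasMinGens (R : Type u) [CommRing R] (𝔪 : Ideal R) (e : ℕ) : Prop :=
  (∃ s : Finset R, s.card = e ∧ Ideal.span (s : Set R) = 𝔪) ∧
  ∀ s : Finset R, Ideal.span (s : Set R) = 𝔪 → e ≤ s.card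

/-- `R` is a regular local ring with maximal ideal `𝔪`: `𝔪` is generated by
`dim R` elements. -/
def IsRegularWrt (R : Type u) [CommRing R] (𝔪 : Ideal R) : Prop :=
  ∃ s : Finset R, Ideal.span (s : Set R) = 𝔪 ∧ (s.card : WithBot ℕ∞) = ringKrullDim R

/-- The local ring `(R, 𝔪)` of dimension `d` has Hilbert–Samuel multiplicity `e`:
the function `n ↦ length (R / 𝔪^(n+1))` eventually agrees with a polynomial of
degree `d` whose leading coefficient is `e / d!`. -/
def HasHSMultiplicity (R : Type u) [CommRing R] (𝔪 : Ideal R) (d e : ℕ) : Prop :=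
  ∃ p : Polynomial ℚ, p.natDegree = d ∧ p.leadingCoeff * (d.factorial : ℚ) = e ∧
    ∀ᶠ n : ℕ in Filter.atTop, ∃ l : ℕ,
      Order.krullDim (Submodule R (R ⧸ 𝔪 ^ (n + 1))) = l ∧ (l : ℚ) = p.eval (n : ℚ)

/-- The projection onto `I` along `J`, defined on a submodule contained in `I ⊔ J`. -/
theorem Submodule.exists_proj_of_disjoint {R M : Type*} [Ring R] [AddCommGroup M] [Module R M]
    {I J : Submodule R M} (h : I ⊓ J = ⊥) :
    ∃ p : ↥(I ⊔ J) →ₗ[R] ↥I, ∀ (x : I) (hx : (x : M) ∈ I ⊔ J), p ⟨x, hx⟩ = x := by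
  have h_inj : Function.Injective (I.subtype.coprod J.subtype) := by
    rw [← LinearMap.ker_eq_bot, LinearMap.ker_coprod_of_disjoint_range]
    · simp
    · simpa [disjoint_iff] using h
  have h_range : LinearMap.range (I.subtype.coprod J.subtype) = I ⊔ J := by
    simp [LinearMap.range_coprod]
  refine ⟨LinearMap.fst R I J ∘ₗ (LinearEquiv.ofInjective _ h_inj).symm.toLinearMap ∘ₗ
    (LinearEquiv.ofEq _ _ h_range.symm).toLinearMap, fun x hx => ?_⟩
  have key : LinearEquiv.ofEq _ _ h_range.symm ⟨x, hx⟩ =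
      LinearEquiv.ofInjective _ h_inj (x, 0) := by
    ext
    simp
  simp [key]

theorem MinFreeRes.isDirectSummand_syz_one {R : Type u} [CommRing R] {𝔪 I J : Ideal R}
    (F : MinFreeRes R 𝔪 ↥J) (hJ : J ≠ ⊥) (hdisj : I ⊓ J = ⊥) (hsum : I ⊔ J = 𝔪) :
    IsDirectSummand R ↥I (F.Syz 1) := by
  change IsDirectSummand R ↥I ↥(LinearMap.range (F.d 0))
  have : Nonempty (Fin (F.b 0)) := by
    by_contra h
    rw [not_nonempty_iff] at h
    refine hJ ((Submodule.subsingleton_iff_eq_bot).1 F.aug_surj.subsingleton)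
  obtain ⟨k⟩ := this
  obtain ⟨p, hp⟩ := Submodule.exists_proj_of_disjoint hdisj
  have h_coord (y : LinearMap.range (F.d 0)) : (y : Fin (F.b 0) → R) k ∈ I ⊔ J := by
    have h := Submodule.mem_map_of_mem (f := LinearMap.proj (φ := fun _ => R) k)
      (F.minimal 0 y.2)
    rw [Submodule.map_smul''] at h
    exact hsum.ge (Submodule.smul_le.2 (fun r hr n _ => 𝔪.mul_mem_right n hr) h)
  have h_single (x : I) : LinearMap.single R (fun _ => R) k (x : R) ∈
      LinearMap.range (F.d 0) := by
    rw [F.exact_aug, LinearMap.mem_ker]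
    have hx : LinearMap.single R (fun _ => R) k (x : R) =
        (x : R) • LinearMap.single R (fun _ => R) k (1 : R) := by
      rw [← map_smul, smul_eq_mul, mul_one]
    rw [hx, map_smul]
    ext
    refine (Submodule.mem_bot R).1 (hdisj.le ?_)
    exact ⟨I.mul_mem_right _ x.2, J.mul_mem_left _ (Subtype.property _)⟩
  refine ⟨(LinearMap.single R (fun _ => R) k ∘ₗ I.subtype).codRestrict _ h_single,
    p ∘ₗ (LinearMap.proj k ∘ₗ (LinearMap.range (F.d 0)).subtype).codRestrict _ h_coord, ?_⟩
  ext1 x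
  have hx : (LinearMap.proj k ∘ₗ (LinearMap.range (F.d 0)).subtype).codRestrict _ h_coord
      ((LinearMap.single R (fun _ => R) k ∘ₗ I.subtype).codRestrict _ h_single x) =
      ⟨(x : R), Submodule.mem_sup_left x.2⟩ := by
    ext
    exact Pi.single_eq_same (M := fun _ => R) k (x : R)
  rw [LinearMap.comp_apply, LinearMap.comp_apply, hx, hp, LinearMap.id_apply]

/-- if `𝔪 = I ⊕ J` with `I, J` nonzero ideals, then `I` is a direct
summand of `Ω_R(J)` and `J` is a direct summand of `Ω_R(I)`. -/
theorem stmt0 (R : Type u) [CommRing R] [IsNoetherianRing R] [IsLocalRing R]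
    (I J : Ideal R) (hI : I ≠ ⊥) (hJ : J ≠ ⊥)
    (hdisj : I ⊓ J = ⊥) (hsum : I ⊔ J = IsLocalRing.maximalIdeal R) :
    (∀ F : MinFreeRes R (IsLocalRing.maximalIdeal R) ↥J,
      IsDirectSummand R ↥I (F.Syz 1)) ∧
    (∀ F : MinFreeRes R (IsLocalRing.maximalIdeal R) ↥I,
      IsDirectSummand R ↥J (F.Syz 1)) := by
  exact ⟨fun F => F.isDirectSummand_syz_one hJ hdisj hsum,
    fun F => F.isDirectSummand_syz_one hI (inf_comm I J ▸ hdisj) (sup_comm I J ▸ hsum)⟩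
end

section
/- Let (R, m) be a commutative noetherian local ring and let M be a finitely generated R-module with no nonzero free direct summand. Then the natural map Hom_R(M, m) → Hom_R(M, R) induced by the inclusion m ⊆ R is an isomorphism. If moreover Ext¹_R(M, R) = 0, then Ext¹_R(M, m) ≅ Hom_R(M, k), where k = R/m. -/
universe u

open IsLocalRing

/-- A linear functional on a module without the ring as a direct summand takes values in the
maximal ideal. -/
theorem apply_mem_maximalIdeal_of_not_isDirectSummand {R : Type u} [CommRing R] [IsLocalRing R]
    {M : Type u} [AddCommGroup M] [Module R M] (hfree : ¬ IsDirectSummand R R M)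
    (f : M →ₗ[R] R) (x : M) : f x ∈ maximalIdeal R := by
  rw [mem_maximalIdeal, mem_nonunits_iff]
  intro hx
  obtain ⟨u, hu⟩ := hx
  refine hfree ⟨LinearMap.toSpanSingleton R M ((↑u⁻¹ : R) • x), f, ?_⟩
  ext
  simp [← hu]

/-- Composition with the inclusion of the maximal ideal is bijective on linear functionals of a
module without the ring as a direct summand. -/
theorem bijective_subtype_comp_of_not_isDirectSummand {R : Type u} [CommRing R] [IsLocalRing R]
    {M : Type u} [AddCommGroup M] [Module R M] (hfree : ¬ IsDirectSummand R R M) :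
    Function.Bijective
      (fun f : M →ₗ[R] ↥(maximalIdeal R) => (maximalIdeal R).subtype ∘ₗ f) := by
  refine ⟨fun f g h => ?_, fun f => ⟨f.codRestrict (maximalIdeal R)
    (apply_mem_maximalIdeal_of_not_isDirectSummand hfree f), rfl⟩⟩
  ext x
  exact LinearMap.congr_fun h x

namespace MinFreeRes

variable {R : Type u} [CommRing R] {𝔪 : Ideal R} {M : Type u} [AddCommGroup M] [Module R M]

theorem apply_d_mem (F : MinFreeRes R 𝔪 M) (n : ℕ) (h : (Fin (F.b n) → R) →ₗ[R] R)
    (x : Fin (F.b (n + 1)) → R) : h (F.d n x) ∈ 𝔪 := by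
  have hx := Submodule.mem_map_of_mem (f := h) (F.minimal n ⟨x, rfl⟩)
  rw [Submodule.map_smul''] at hx
  simpa using Submodule.smul_mono le_rfl le_top hx

theorem d_d_apply (F : MinFreeRes R 𝔪 M) (n : ℕ) (x : Fin (F.b (n + 2)) → R) :
    F.d n (F.d (n + 1) x) = 0 := by
  have hx : F.d (n + 1) x ∈ LinearMap.ker (F.d n) := F.exact n ▸ ⟨x, rfl⟩
  exact hx

theorem aug_d_apply (F : MinFreeRes R 𝔪 M) (x : Fin (F.b 1) → R) : F.aug (F.d 0 x) = 0 := by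
  have hx : F.d 0 x ∈ LinearMap.ker F.aug := F.exact_aug ▸ ⟨x, rfl⟩
  exact hx

/-- A map on the free module in degree zero which vanishes on the image of the first
differential factors through the augmentation. -/
theorem exists_comp_aug_eq (F : MinFreeRes R 𝔪 M) {N : Type*} [AddCommGroup N] [Module R N]
    (h : (Fin (F.b 0) → R) →ₗ[R] N) (hd : ∀ x, h (F.d 0 x) = 0) :
    ∃ f : M →ₗ[R] N, f ∘ₗ F.aug = h := by
  have hk : LinearMap.ker F.aug ≤ LinearMap.ker h := by
    rw [← F.exact_aug]
    rintro _ ⟨x, rfl⟩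
    exact hd x
  refine ⟨(LinearMap.ker F.aug).liftQ h hk ∘ₗ
    (F.aug.quotKerEquivOfSurjective F.aug_surj).symm.toLinearMap, ?_⟩
  ext1 x
  ext
  have e : (F.aug.quotKerEquivOfSurjective F.aug_surj).symm (F.aug (Pi.single x 1)) =
      (LinearMap.ker F.aug).mkQ (Pi.single x 1) := by
    rw [LinearEquiv.symm_apply_eq]
    rfl
  simp [e]

/-- The cocycle with values in `𝔪` obtained by restricting a functional along the first
differential of a minimal resolution. -/
def coboundary (F : MinFreeRes R 𝔪 M) : ((Fin (F.b 0) → R) →ₗ[R] R) →ₗ[R]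
    ↥(LinearMap.ker (LinearMap.lcomp R ↥𝔪 (F.d 1))) where
  toFun h := ⟨(h ∘ₗ F.d 0).codRestrict 𝔪 (F.apply_d_mem 0 h), by
    rw [LinearMap.mem_ker]
    refine LinearMap.ext fun x => Subtype.ext ?_
    change h (F.d 0 (F.d 1 x)) = 0
    rw [F.d_d_apply, map_zero]⟩
  map_add' _ _ := rfl
  map_smul' _ _ := rfl

/-- The class in `Ext¹` of a cocycle. -/
def ext1Mk (F : MinFreeRes R 𝔪 M) (N : Type u) [AddCommGroup N] [Module R N] :
    ↥(LinearMap.ker (LinearMap.lcomp R N (F.d 1))) →ₗ[R] F.Ext1 N where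
  toFun g := Submodule.Quotient.mk g
  map_add' _ _ := rfl
  map_smul' _ _ := rfl

theorem ext1Mk_surjective (F : MinFreeRes R 𝔪 M) (N : Type u) [AddCommGroup N] [Module R N] :
    Function.Surjective (F.ext1Mk N) :=
  Quotient.mk_surjective

theorem ext1Mk_eq_zero_iff (F : MinFreeRes R 𝔪 M) {N : Type u} [AddCommGroup N] [Module R N]
    (g : ↥(LinearMap.ker (LinearMap.lcomp R N (F.d 1)))) :
    F.ext1Mk N g = 0 ↔ g.1 ∈ LinearMap.range (LinearMap.lcomp R N (F.d 0)) :=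
  Submodule.Quotient.mk_eq_zero _

/-- The connecting map sending a functional on the free module in degree zero to the class of
its coboundary. -/
def connecting (F : MinFreeRes R 𝔪 M) : ((Fin (F.b 0) → R) →ₗ[R] R) →ₗ[R] F.Ext1 ↥𝔪 :=
  F.ext1Mk ↥𝔪 ∘ₗ F.coboundary

theorem connecting_surjective (F : MinFreeRes R 𝔪 M) (hF : Subsingleton (F.Ext1 R)) :
    Function.Surjective F.connecting := by
  intro y
  obtain ⟨g, rfl⟩ := F.ext1Mk_surjective _ y
  have hg : 𝔪.subtype ∘ₗ g.1 ∈ LinearMap.ker (LinearMap.lcomp R R (F.d 1)) := by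
    rw [LinearMap.mem_ker]
    refine LinearMap.ext fun x => ?_
    exact congrArg Subtype.val (LinearMap.congr_fun (LinearMap.mem_ker.1 g.2) x)
  obtain ⟨h, hh⟩ : 𝔪.subtype ∘ₗ g.1 ∈ LinearMap.range (LinearMap.lcomp R R (F.d 0)) :=
    (F.ext1Mk_eq_zero_iff ⟨_, hg⟩).1 (hF.elim _ _)
  refine ⟨h, ?_⟩
  refine congrArg (F.ext1Mk _) (Subtype.ext (LinearMap.ext fun x => Subtype.ext ?_))
  exact LinearMap.congr_fun hh x

theorem mem_ker_connecting_iff (F : MinFreeRes R 𝔪 M)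
    (hM : ∀ (f : M →ₗ[R] R) (x : M), f x ∈ 𝔪) (h : (Fin (F.b 0) → R) →ₗ[R] R) :
    h ∈ LinearMap.ker F.connecting ↔ ∀ x, h x ∈ 𝔪 := by
  have key : h ∈ LinearMap.ker F.connecting ↔
      (F.coboundary h).1 ∈ LinearMap.range (LinearMap.lcomp R ↥𝔪 (F.d 0)) :=
    F.ext1Mk_eq_zero_iff _
  rw [key]
  constructor
  · rintro ⟨h', hh'⟩ x
    obtain ⟨f, hf⟩ := F.exists_comp_aug_eq (h - 𝔪.subtype ∘ₗ h') fun y => by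
      have hy : ((h' (F.d 0 y) : 𝔪) : R) = h (F.d 0 y) :=
        congrArg Subtype.val (LinearMap.congr_fun hh' y)
      simp [hy]
    have hx : f (F.aug x) = h x - h' x := LinearMap.congr_fun hf x
    have := 𝔪.add_mem (hM f (F.aug x)) (h' x).2
    rwa [hx, sub_add_cancel] at this
  · exact fun hx => ⟨h.codRestrict 𝔪 hx, rfl⟩

/-- Over a local ring, precomposition with the augmentation of a minimal resolution identifies
maps to the residue field. -/
theorem bijective_lcomp_aug [IsLocalRing R] (F : MinFreeRes R (maximalIdeal R) M) :
    Function.Bijective (LinearMap.lcomp R (ResidueField R) F.aug) := by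
  refine ⟨fun f g h => LinearMap.ext fun x => ?_, fun h => ?_⟩
  · obtain ⟨y, rfl⟩ := F.aug_surj x
    exact LinearMap.congr_fun h y
  · obtain ⟨h', hh'⟩ := Module.projective_lifting_property
      (Algebra.linearMap R (ResidueField R)) h residue_surjective
    refine F.exists_comp_aug_eq h fun x => ?_
    rw [← hh']
    exact (residue_eq_zero_iff _).2 (F.apply_d_mem 0 h' x)

/-- If all functionals on `M` take values in the maximal ideal and `Ext¹(M, R) = 0`, then
`Ext¹(M, 𝔪) ≅ Hom(M, k)`. -/
theorem nonempty_ext1_maximalIdeal_equiv [IsLocalRing R] (F : MinFreeRes R (maximalIdeal R) M)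
    (hM : ∀ (f : M →ₗ[R] R) (x : M), f x ∈ maximalIdeal R) (hF : Subsingleton (F.Ext1 R)) :
    Nonempty (F.Ext1 ↥(maximalIdeal R) ≃ₗ[R] (M →ₗ[R] ResidueField R)) := by
  let ψ : ((Fin (F.b 0) → R) →ₗ[R] R) →ₗ[R] ((Fin (F.b 0) → R) →ₗ[R] ResidueField R) :=
    (Algebra.linearMap R (ResidueField R)).compRight R
  have hψ : Function.Surjective ψ := fun h =>
    Module.projective_lifting_property (Algebra.linearMap R (ResidueField R)) h
      residue_surjective
  have hker : LinearMap.ker F.connecting = LinearMap.ker ψ := by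
    ext h
    rw [F.mem_ker_connecting_iff hM, LinearMap.mem_ker]
    refine ⟨fun hx => LinearMap.ext fun x => (residue_eq_zero_iff _).2 (hx x), fun hx x => ?_⟩
    exact (residue_eq_zero_iff _).1 (LinearMap.congr_fun hx x)
  exact ⟨(F.connecting.quotKerEquivOfSurjective (F.connecting_surjective hF)).symm ≪≫ₗ
    Submodule.quotEquivOfEq _ _ hker ≪≫ₗ ψ.quotKerEquivOfSurjective hψ ≪≫ₗ
    (LinearEquiv.ofBijective _ F.bijective_lcomp_aug).symm⟩

end MinFreeRes

/-- if `M` has no nonzero free direct summand, then the natural map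
`Hom(M, 𝔪) → Hom(M, R)` is bijective; if moreover `Ext¹(M, R) = 0`, then
`Ext¹(M, 𝔪) ≅ Hom(M, k)`. -/
theorem stmt2 (R : Type u) [CommRing R] [IsNoetherianRing R] [IsLocalRing R]
    (M : Type u) [AddCommGroup M] [Module R M] [Module.Finite R M]
    (hfree : ¬ IsDirectSummand R R M) :
    Function.Bijective
      (fun f : M →ₗ[R] ↥(IsLocalRing.maximalIdeal R) =>
        (IsLocalRing.maximalIdeal R).subtype ∘ₗ f) ∧
    (∀ F : MinFreeRes R (IsLocalRing.maximalIdeal R) M,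
      Subsingleton (F.Ext1 R) →
        Nonempty (F.Ext1 ↥(IsLocalRing.maximalIdeal R) ≃ₗ[R]
          (M →ₗ[R] IsLocalRing.ResidueField R))) := by
  exact ⟨bijective_subtype_comp_of_not_isDirectSummand hfree, fun F hF =>
    F.nonempty_ext1_maximalIdeal_equiv
      (apply_mem_maximalIdeal_of_not_isDirectSummand hfree) hF⟩
end

section
/- Let (R, m) be a commutative noetherian local ring, I a proper ideal of R, and M a finitely generated R-module. Then there is an isomorphism of R/I-modules Tr_R(M)/I·Tr_R(M) ≅ Tr_{R/I}(M/IM) ⊕ (R/I)^{β₁^R(M) − β₁^{R/I}(M/IM)}, where β₁ denotes the first Betti number. -/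
universe u

section Cover

variable {S : Type u} [CommRing S] [IsLocalRing S] {K : Type u} [AddCommGroup K] [Module S K]

/-- Over a local ring, a minimal free cover is a direct summand of any free cover. -/
theorem exists_equiv_prod_of_minimal_cover {n : Ideal S} (hn : n ≤ IsLocalRing.maximalIdeal S)
    {f g : ℕ} (p : (Fin f → S) →ₗ[S] K) (q : (Fin g → S) →ₗ[S] K)
    (hp : Function.Surjective p) (hq : Function.Surjective q)
    (hmin : LinearMap.ker q ≤ n • (⊤ : Submodule S (Fin g → S))) :
    g ≤ f ∧ ∃ e : (Fin f → S) ≃ₗ[S] (Fin g → S) × (Fin (f - g) → S),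
      p = q ∘ₗ LinearMap.fst S _ _ ∘ₗ e.toLinearMap := by
  obtain ⟨h, hh⟩ := Module.projective_lifting_property q p hq
  have hsurj : Function.Surjective h := by
    rw [← LinearMap.range_eq_top, eq_top_iff]
    refine Submodule.le_of_le_smul_of_le_jacobson_bot (I := n) Module.Finite.fg_top
      (hn.trans (IsLocalRing.jacobson_eq_maximalIdeal ⊥ bot_ne_top).ge) ?_
    intro x _
    obtain ⟨y, hy⟩ := hp (q x)
    rw [← hh] at hy
    have hx : x - h y ∈ LinearMap.ker q := by
      simp only [LinearMap.comp_apply] at hy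
      simp [hy]
    rw [← add_sub_cancel (h y) x]
    exact Submodule.add_mem_sup ⟨y, rfl⟩ (hmin hx)
  obtain ⟨s, hs⟩ := Module.projective_lifting_property h LinearMap.id hsurj
  have hinv : Function.LeftInverse h s := fun x => LinearMap.congr_fun hs x
  let E : (Fin f → S) ≃ₗ[S] (Fin g → S) × LinearMap.ker h :=
    { toFun := fun x => (h x, ⟨x - s (h x), by simp [hinv (h x)]⟩)
      map_add' := fun x y => by
        ext : 1
        · simp
        · ext : 1
          simp only [map_add, Prod.mk_add_mk, AddMemClass.mk_add_mk]
          abel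
      map_smul' := fun c x => by
        ext : 1
        · simp
        · ext : 1
          simp [smul_sub]
      invFun := fun z => s z.1 + z.2
      left_inv := fun x => by simp
      right_inv := fun z => by
        have hz : h (z.2 : Fin f → S) = 0 := z.2.2
        ext : 1
        · simp [hinv z.1, hz]
        · ext : 1
          simp [hinv z.1, hz] }
  let k := (LinearMap.snd S (Fin g → S) (LinearMap.ker h)) ∘ₗ E.toLinearMap
  have hk : Function.Surjective k := Prod.snd_surjective.comp E.surjective
  have : Module.Finite S (LinearMap.ker h) := Module.Finite.of_surjective k hk
  have : Module.Projective S (LinearMap.ker h) :=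
    Module.Projective.of_split (LinearMap.ker h).subtype k (by
      ext x : 1
      have hx : h (x : Fin f → S) = 0 := x.2
      ext : 1
      simp [k, E, hx])
  have : Module.Free S (LinearMap.ker h) := Module.free_of_flat_of_isLocalRing
  have hrank := E.finrank_eq
  rw [Module.finrank_prod, Module.finrank_fin_fun, Module.finrank_fin_fun] at hrank
  have e₂ : LinearMap.ker h ≃ₗ[S] (Fin (f - g) → S) :=
    LinearEquiv.ofFinrankEq _ _ (by rw [Module.finrank_fin_fun]; omega)
  refine ⟨by omega, E.trans ((LinearEquiv.refl S _).prodCongr e₂), ?_⟩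
  rw [← hh]
  rfl

end Cover

section QuotientByIdeal

variable {R : Type u} [CommRing R] (I : Ideal R)

/-- Coordinatewise reduction modulo an ideal. -/
def reduceCoord (n : ℕ) : (Fin n → R) →ₗ[R] (Fin n → R ⧸ I) :=
  (Algebra.linearMap R (R ⧸ I)).compLeft (Fin n)

theorem reduceCoord_surjective (n : ℕ) : Function.Surjective (reduceCoord I n) := fun y => by
  choose x hx using fun i => Ideal.Quotient.mk_surjective (y i)
  exact ⟨x, funext hx⟩

theorem reduceCoord_mem_smul_top {J : Ideal R} {n : ℕ} {x : Fin n → R}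
    (hx : x ∈ (J • ⊤ : Submodule R (Fin n → R))) :
    reduceCoord I n x ∈
      (J.map (Ideal.Quotient.mk I) • ⊤ : Submodule (R ⧸ I) (Fin n → R ⧸ I)) := by
  induction hx using Submodule.smul_induction_on' with
  | smul r hr y _ =>
    rw [map_smul, ← algebraMap_smul (R ⧸ I)]
    exact Submodule.smul_mem_smul (Ideal.mem_map_of_mem _ hr) trivial
  | add x _ y _ hx hy => rw [map_add]; exact add_mem hx hy

theorem eq_of_comp_reduceCoord_eq {P : Type u} [AddCommGroup P] [Module (R ⧸ I) P] {n : ℕ}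
    {φ ψ : (Fin n → R ⧸ I) →ₗ[R ⧸ I] P}
    (h : ∀ x, φ (reduceCoord I n x) = ψ (reduceCoord I n x)) : φ = ψ := by
  refine LinearMap.ext fun y => ?_
  obtain ⟨x, rfl⟩ := reduceCoord_surjective I n y
  exact h x

variable {P : Type u} [AddCommGroup P] [Module R P] [Module (R ⧸ I) P] [IsScalarTower R (R ⧸ I) P]

/-- The `R ⧸ I`-linear map out of `(R ⧸ I)ⁿ` induced by an `R`-linear map out of `Rⁿ`. -/
noncomputable def liftCoord {n : ℕ} (φ : (Fin n → R) →ₗ[R] P) : (Fin n → R ⧸ I) →ₗ[R ⧸ I] P :=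
  (Pi.basisFun (R ⧸ I) (Fin n)).constr (R ⧸ I) fun i => φ (Pi.single i 1)

theorem liftCoord_reduceCoord {n : ℕ} (φ : (Fin n → R) →ₗ[R] P) (x : Fin n → R) :
    liftCoord I φ (reduceCoord I n x) = φ x := by
  have : ((liftCoord I φ).restrictScalars R) ∘ₗ reduceCoord I n = φ := by
    refine (Pi.basisFun R (Fin n)).ext fun i => ?_
    have hs : reduceCoord I n (Pi.single i 1) = Pi.single i 1 := by
      ext j
      by_cases h : j = i
      · subst h; simp [reduceCoord]
      · simp [reduceCoord, h]
    simp only [Pi.basisFun_apply, LinearMap.comp_apply, LinearMap.restrictScalars_apply, hs]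
    simp [liftCoord]
  exact LinearMap.congr_fun this x

/-- Reduction of functionals on `Rⁿ` modulo an ideal. -/
noncomputable def reduceDual (n : ℕ) :
    Module.Dual R (Fin n → R) →ₗ[R] Module.Dual (R ⧸ I) (Fin n → R ⧸ I) where
  toFun φ := liftCoord I (Algebra.linearMap R (R ⧸ I) ∘ₗ φ)
  map_add' φ ψ := eq_of_comp_reduceCoord_eq I fun x => by
    simp [liftCoord_reduceCoord]
  map_smul' r φ := eq_of_comp_reduceCoord_eq I fun x => by
    simp only [LinearMap.smul_apply, RingHom.id_apply, liftCoord_reduceCoord]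
    simp [Algebra.smul_def]

theorem reduceDual_reduceCoord {n : ℕ} (φ : Module.Dual R (Fin n → R)) (x : Fin n → R) :
    reduceDual I n φ (reduceCoord I n x) = Ideal.Quotient.mk I (φ x) :=
  liftCoord_reduceCoord I _ x

theorem reduceDual_surjective (n : ℕ) : Function.Surjective (reduceDual I n) := fun ψ => by
  obtain ⟨φ, hφ⟩ := Module.projective_lifting_property (Algebra.linearMap R (R ⧸ I))
    (ψ.restrictScalars R ∘ₗ reduceCoord I n) Ideal.Quotient.mk_surjective
  refine ⟨φ, eq_of_comp_reduceCoord_eq I fun x => ?_⟩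
  rw [reduceDual_reduceCoord]
  exact LinearMap.congr_fun hφ x

theorem mem_smul_top_of_reduceDual_eq_zero {n : ℕ} {φ : Module.Dual R (Fin n → R)}
    (h : reduceDual I n φ = 0) : φ ∈ (I • ⊤ : Submodule R (Module.Dual R (Fin n → R))) := by
  have hφ : φ = ∑ i, φ (Pi.single i 1) • (LinearMap.proj i : (Fin n → R) →ₗ[R] R) := by
    refine (Pi.basisFun R (Fin n)).ext fun i => ?_
    simp [Pi.single_apply]
  rw [hφ]
  refine Submodule.sum_mem _ fun i _ => Submodule.smul_mem_smul ?_ trivial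
  rw [← Ideal.Quotient.eq_zero_iff_mem, ← reduceDual_reduceCoord, h, LinearMap.zero_apply]

/-- A surjection onto an `R ⧸ I`-module with kernel inside `I • N` identifies it with `N / IN`. -/
theorem nonempty_quotient_smul_top_equiv {N : Type u} [AddCommGroup N] [Module R N]
    (T : N →ₗ[R] P) (hT : Function.Surjective T)
    (hker : LinearMap.ker T ≤ (I • ⊤ : Submodule R N)) :
    Nonempty ((N ⧸ (I • ⊤ : Submodule R N)) ≃ₗ[R ⧸ I] P) := by
  have hle : (I • ⊤ : Submodule R N) ≤ LinearMap.ker T := by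
    refine Submodule.smul_le.mpr fun r hr x _ => ?_
    rw [LinearMap.mem_ker, map_smul, ← algebraMap_smul (R ⧸ I) r (T x),
      show algebraMap R (R ⧸ I) r = 0 from Ideal.Quotient.eq_zero_iff_mem.mpr hr, zero_smul]
  exact ⟨LinearEquiv.extendScalarsOfSurjective (S := R ⧸ I) Ideal.Quotient.mk_surjective
    ((Submodule.quotEquivOfEq _ _ (le_antisymm hle hker)).trans
      (T.quotKerEquivOfSurjective hT))⟩

/-- The reduction modulo `I` of a linear map between finite free modules. -/
noncomputable def reduceMap {m n : ℕ} (d : (Fin m → R) →ₗ[R] (Fin n → R)) :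
    (Fin m → R ⧸ I) →ₗ[R ⧸ I] (Fin n → R ⧸ I) :=
  liftCoord I (reduceCoord I n ∘ₗ d)

theorem reduceMap_reduceCoord {m n : ℕ} (d : (Fin m → R) →ₗ[R] (Fin n → R)) (x : Fin m → R) :
    reduceMap I d (reduceCoord I m x) = reduceCoord I n (d x) :=
  liftCoord_reduceCoord I _ x

/-- The cokernel of the dual of a map commutes with reduction modulo an ideal. -/
theorem nonempty_coker_dual_quotient_equiv {m n : ℕ} (d : (Fin m → R) →ₗ[R] (Fin n → R)) :
    Nonempty (((Module.Dual R (Fin m → R) ⧸ LinearMap.range d.dualMap) ⧸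
        (I • ⊤ : Submodule R (Module.Dual R (Fin m → R) ⧸ LinearMap.range d.dualMap)))
      ≃ₗ[R ⧸ I]
      (Module.Dual (R ⧸ I) (Fin m → R ⧸ I) ⧸ LinearMap.range (reduceMap I d).dualMap)) := by
  have hcomm : ∀ χ : Module.Dual R (Fin n → R),
      reduceDual I m (d.dualMap χ) = (reduceMap I d).dualMap (reduceDual I n χ) := fun χ =>
    eq_of_comp_reduceCoord_eq I fun x => by
      rw [reduceDual_reduceCoord, LinearMap.dualMap_apply, LinearMap.dualMap_apply,
        reduceMap_reduceCoord, reduceDual_reduceCoord]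
  let π := (LinearMap.range (reduceMap I d).dualMap).mkQ.restrictScalars R
  let T : (Module.Dual R (Fin m → R) ⧸ LinearMap.range d.dualMap) →ₗ[R]
      (Module.Dual (R ⧸ I) (Fin m → R ⧸ I) ⧸ LinearMap.range (reduceMap I d).dualMap) :=
    Submodule.liftQ _ (π ∘ₗ reduceDual I m) (by
      rintro _ ⟨χ, rfl⟩
      rw [LinearMap.mem_ker, LinearMap.comp_apply, hcomm]
      exact (Submodule.Quotient.mk_eq_zero _).mpr ⟨_, rfl⟩)
  refine nonempty_quotient_smul_top_equiv I T ?_ ?_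
  · intro y
    obtain ⟨ψ, rfl⟩ := Submodule.mkQ_surjective _ y
    obtain ⟨φ, rfl⟩ := reduceDual_surjective I m ψ
    exact ⟨Submodule.Quotient.mk φ, rfl⟩
  · intro y hy
    obtain ⟨φ, rfl⟩ := Submodule.mkQ_surjective _ y
    obtain ⟨ψ, hψ⟩ := (Submodule.Quotient.mk_eq_zero _).mp
      (show Submodule.Quotient.mk (reduceDual I m φ) = 0 from hy)
    obtain ⟨χ, rfl⟩ := reduceDual_surjective I n ψ
    rw [← hcomm, eq_comm, ← sub_eq_zero, ← map_sub] at hψ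
    have hmem := Submodule.mem_map_of_mem (f := (LinearMap.range d.dualMap).mkQ)
      (mem_smul_top_of_reduceDual_eq_zero I hψ)
    rw [Submodule.map_smul'', map_sub, Submodule.mkQ_apply _ (d.dualMap χ),
      (Submodule.Quotient.mk_eq_zero (LinearMap.range d.dualMap)).mpr ⟨χ, rfl⟩, sub_zero] at hmem
    exact Submodule.smul_mono le_rfl le_top hmem

theorem range_reduceMap_eq_ker_liftCoord {M : Type u} [AddCommGroup M] [Module R M] {m n : ℕ}
    (d : (Fin m → R) →ₗ[R] (Fin n → R)) (aug : (Fin n → R) →ₗ[R] M)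
    (haug : Function.Surjective aug) (hexact : LinearMap.range d = LinearMap.ker aug) :
    LinearMap.range (reduceMap I d) =
      LinearMap.ker (liftCoord I ((I • ⊤ : Submodule R M).mkQ ∘ₗ aug)) := by
  apply le_antisymm
  · rintro _ ⟨y, rfl⟩
    obtain ⟨x, rfl⟩ := reduceCoord_surjective I m y
    have hx : aug (d x) = 0 := by
      rw [← LinearMap.mem_ker, ← hexact]
      exact ⟨x, rfl⟩
    rw [LinearMap.mem_ker, reduceMap_reduceCoord, liftCoord_reduceCoord, LinearMap.comp_apply, hx,
      map_zero]
  · intro y hy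
    obtain ⟨x, rfl⟩ := reduceCoord_surjective I n y
    rw [LinearMap.mem_ker, liftCoord_reduceCoord, LinearMap.comp_apply, Submodule.mkQ_apply,
      Submodule.Quotient.mk_eq_zero, ← LinearMap.range_eq_top.mpr haug, ← Submodule.map_top,
      ← Submodule.map_smul''] at hy
    obtain ⟨z, hz, hzx⟩ := hy
    have hker : x - z ∈ LinearMap.ker aug := by simp [hzx]
    rw [← hexact] at hker
    obtain ⟨w, hw⟩ := hker
    have hz0 : reduceCoord I n z = 0 := by
      have := reduceCoord_mem_smul_top I hz
      rwa [Ideal.map_quotient_self, Submodule.bot_smul, Submodule.mem_bot] at this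
    refine ⟨reduceCoord I m w, ?_⟩
    rw [reduceMap_reduceCoord, hw, map_sub, hz0, sub_zero]

end QuotientByIdeal

/-- The cokernel of the dual is unchanged, up to a free summand, by precomposing with a split
projection from a free module and postcomposing with an isomorphism. -/
theorem nonempty_coker_dual_equiv_prod {S : Type u} [CommRing S] {f f' g g' k : ℕ}
    (a : (Fin f → S) →ₗ[S] (Fin f' → S)) (b : (Fin g → S) →ₗ[S] (Fin g' → S))
    (e₀ : (Fin f' → S) ≃ₗ[S] (Fin g' → S))
    (e : (Fin f → S) ≃ₗ[S] (Fin g → S) × (Fin k → S))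
    (h : e₀.toLinearMap ∘ₗ a = b ∘ₗ LinearMap.fst S _ _ ∘ₗ e.toLinearMap) :
    Nonempty ((Module.Dual S (Fin f → S) ⧸ LinearMap.range a.dualMap) ≃ₗ[S]
      (Module.Dual S (Fin g → S) ⧸ LinearMap.range b.dualMap) × (Fin k → S)) := by
  let ι₁ : (Fin g → S) →ₗ[S] (Fin f → S) := e.symm.toLinearMap ∘ₗ LinearMap.inl S _ _
  let ι₂ : (Fin k → S) →ₗ[S] (Fin f → S) := e.symm.toLinearMap ∘ₗ LinearMap.inr S _ _
  let δ : Module.Dual S (Fin k → S) ≃ₗ[S] (Fin k → S) :=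
    (Pi.basisFun S (Fin k)).toDualEquiv.symm
  let T : Module.Dual S (Fin f → S) →ₗ[S]
      (Module.Dual S (Fin g → S) ⧸ LinearMap.range b.dualMap) × (Fin k → S) :=
    ((LinearMap.range b.dualMap).mkQ ∘ₗ ι₁.dualMap).prod (δ.toLinearMap ∘ₗ ι₂.dualMap)
  have hT : Function.Surjective T := by
    rintro ⟨y, v⟩
    obtain ⟨φ, rfl⟩ := Submodule.mkQ_surjective _ y
    refine ⟨(φ.coprod (δ.symm v)) ∘ₗ e.toLinearMap, Prod.ext ?_ ?_⟩
    · refine congrArg (Submodule.mkQ _) (LinearMap.ext fun x => ?_)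
      simp [ι₁, LinearMap.dualMap_apply]
    · refine (congrArg δ (LinearMap.ext fun x => ?_)).trans (δ.apply_symm_apply v)
      simp [ι₂, LinearMap.dualMap_apply]
  have hker : LinearMap.range a.dualMap = LinearMap.ker T := by
    have ha : a = e₀.symm.toLinearMap ∘ₗ b ∘ₗ LinearMap.fst S _ _ ∘ₗ e.toLinearMap := by
      rw [← h]; ext1; simp
    apply le_antisymm
    · rintro _ ⟨χ, rfl⟩
      refine LinearMap.mem_ker.mpr (Prod.ext ?_ ?_)
      · refine (Submodule.Quotient.mk_eq_zero _).mpr ⟨χ ∘ₗ e₀.symm.toLinearMap, ?_⟩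
        refine LinearMap.ext fun x => ?_
        simp [ι₁, ha, LinearMap.dualMap_apply]
      · refine (LinearEquiv.map_eq_zero_iff δ).mpr (LinearMap.ext fun x => ?_)
        simp [ι₂, ha, LinearMap.dualMap_apply]
    · intro φ hφ
      obtain ⟨h₁, h₂⟩ := Prod.ext_iff.mp (LinearMap.mem_ker.mp hφ)
      obtain ⟨χ, hχ⟩ := (Submodule.Quotient.mk_eq_zero _).mp h₁
      have h₂' : ι₂.dualMap φ = 0 := (LinearEquiv.map_eq_zero_iff δ).mp h₂
      refine ⟨χ ∘ₗ e₀.toLinearMap, LinearMap.ext fun x => ?_⟩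
      have hx : x = ι₁ (e x).1 + ι₂ (e x).2 := by
        apply e.injective
        simp [ι₁, ι₂]
      have hφx : φ x = φ (ι₁ (e x).1) + φ (ι₂ (e x).2) := by
        rw [← map_add, ← hx]
      have hφ₁ := LinearMap.congr_fun hχ (e x).1
      have hφ₂ := LinearMap.congr_fun h₂' (e x).2
      simp only [LinearMap.dualMap_apply, LinearMap.zero_apply] at hφ₁ hφ₂
      rw [hφx, hφ₂, add_zero, ← hφ₁, ha]
      simp [LinearMap.dualMap_apply]
  exact ⟨(Submodule.quotEquivOfEq _ _ hker).trans (T.quotKerEquivOfSurjective hT)⟩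

/-- `Tr_R(M)/I·Tr_R(M) ≅ Tr_{R/I}(M/IM) ⊕ (R/I)^{β₁^R(M) − β₁^{R/I}(M/IM)}`
for a proper ideal `I` of `R`. -/
theorem stmt5 (R : Type u) [CommRing R] [IsNoetherianRing R] [IsLocalRing R]
    (I : Ideal R) (hI : I ≠ ⊤)
    (M : Type u) [AddCommGroup M] [Module R M] [Module.Finite R M] :
    ∀ (F : MinFreeRes R (IsLocalRing.maximalIdeal R) M)
      (G : MinFreeRes (R ⧸ I) ((IsLocalRing.maximalIdeal R).map (Ideal.Quotient.mk I))
        (M ⧸ (I • ⊤ : Submodule R M))),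
      G.b 1 ≤ F.b 1 ∧
      Nonempty ((F.Tr ⧸ (I • ⊤ : Submodule R F.Tr)) ≃ₗ[R ⧸ I]
        (G.Tr × (Fin (F.b 1 - G.b 1) → R ⧸ I))) := by
  intro F G
  have : Nontrivial (R ⧸ I) := Ideal.Quotient.nontrivial_iff.mpr hI
  have : IsLocalRing (R ⧸ I) :=
    IsLocalRing.of_surjective' (Ideal.Quotient.mk I) Ideal.Quotient.mk_surjective
  have hn : (IsLocalRing.maximalIdeal R).map (Ideal.Quotient.mk I) ≤
      IsLocalRing.maximalIdeal (R ⧸ I) := by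
    refine IsLocalRing.le_maximalIdeal fun htop => ?_
    have hcomap := Ideal.comap_map_of_surjective' (Ideal.Quotient.mk I)
      Ideal.Quotient.mk_surjective (IsLocalRing.maximalIdeal R)
    rw [htop, Ideal.comap_top, Ideal.mk_ker,
      sup_eq_left.mpr (IsLocalRing.le_maximalIdeal hI)] at hcomap
    exact (IsLocalRing.maximalIdeal.isMaximal R).ne_top hcomap.symm
  let aug := liftCoord I ((I • ⊤ : Submodule R M).mkQ ∘ₗ F.aug)
  let a := reduceMap I (F.d 0)
  have haug : Function.Surjective aug := fun y => by
    obtain ⟨x, rfl⟩ := (Submodule.mkQ_surjective _).comp F.aug_surj y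
    exact ⟨reduceCoord I _ x, liftCoord_reduceCoord I _ x⟩
  have hexact : LinearMap.range a = LinearMap.ker aug :=
    range_reduceMap_eq_ker_liftCoord I (F.d 0) F.aug F.aug_surj F.exact_aug
  have hmin : LinearMap.ker aug ≤
      (IsLocalRing.maximalIdeal R).map (Ideal.Quotient.mk I) • ⊤ := by
    rw [← hexact]
    rintro _ ⟨y, rfl⟩
    obtain ⟨x, rfl⟩ := reduceCoord_surjective I _ y
    rw [reduceMap_reduceCoord]
    exact reduceCoord_mem_smul_top I (F.minimal 0 ⟨x, rfl⟩)
  obtain ⟨hle, E, hE⟩ := exists_equiv_prod_of_minimal_cover hn aug G.aug haug G.aug_surj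
    (G.exact_aug ▸ G.minimal 0)
  obtain ⟨hge, -⟩ := exists_equiv_prod_of_minimal_cover hn G.aug aug G.aug_surj haug hmin
  have : IsEmpty (Fin (F.b 0 - G.b 0)) := by
    rw [Nat.sub_eq_zero_of_le hge]
    infer_instance
  let e₀ := E.trans LinearEquiv.prodUnique
  have he₀ : ∀ x, G.aug (e₀ x) = aug x := fun x => (LinearMap.congr_fun hE x).symm
  have hcod : ∀ x, (e₀.toLinearMap ∘ₗ a) x ∈ LinearMap.range (G.d 0) := fun x => by
    rw [G.exact_aug, LinearMap.mem_ker]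
    exact (he₀ _).trans (LinearMap.mem_ker.mp (hexact ▸ LinearMap.mem_range_self a x))
  obtain ⟨hle₁, e, he⟩ := exists_equiv_prod_of_minimal_cover hn
    ((e₀.toLinearMap ∘ₗ a).codRestrict (LinearMap.range (G.d 0)) hcod) (G.d 0).rangeRestrict
    (by
      rintro ⟨y, hy⟩
      rw [G.exact_aug, LinearMap.mem_ker, ← e₀.apply_symm_apply y, he₀, ← LinearMap.mem_ker,
        ← hexact] at hy
      obtain ⟨x, hx⟩ := hy
      exact ⟨x, Subtype.ext (by simp [hx])⟩)
    (G.d 0).surjective_rangeRestrict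
    (by rw [LinearMap.ker_rangeRestrict, ← G.exact 0]; exact G.minimal 1)
  obtain ⟨t₁⟩ := nonempty_coker_dual_quotient_equiv I (F.d 0)
  obtain ⟨t₂⟩ := nonempty_coker_dual_equiv_prod a (G.d 0) e₀ e
    (LinearMap.ext fun x => congrArg Subtype.val (LinearMap.congr_fun he x))
  exact ⟨hle₁, ⟨t₁.trans t₂⟩⟩
end

section
/- Let (R, m, k) be a commutative noetherian local ring whose maximal ideal m is decomposable as an R-module, i.e., m = I ⊕ J for nonzero ideals I, J. Then m is a direct summand of the second syzygy Ω_R²(k) of the residue field k. -/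
universe u

open IsLocalRing in
/-- A nonzero summand of the maximal ideal of a noetherian local ring is not contained in the
square of the maximal ideal. -/
theorem not_le_maximalIdeal_sq {R : Type u} [CommRing R] [IsNoetherianRing R] [IsLocalRing R]
    {I J : Ideal R} (hJ : J ≠ ⊥) (hdisj : I ⊓ J = ⊥) (hsum : I ⊔ J = maximalIdeal R) :
    ¬ J ≤ maximalIdeal R * maximalIdeal R := by
  intro h
  have hIJ : I * J = ⊥ := le_bot_iff.1 (hdisj ▸ Ideal.mul_le_inf)
  have hJm : J ≤ maximalIdeal R := hsum ▸ le_sup_right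
  have hsq : maximalIdeal R * maximalIdeal R = I * I ⊔ J * J := by
    rw [← hsum, Ideal.sup_mul, Ideal.mul_sup, Ideal.mul_sup, mul_comm J I, hIJ]
    simp
  refine hJ (Submodule.eq_bot_of_le_smul_of_le_jacobson_bot J J
    (IsNoetherian.noetherian J) (fun x hx ↦ ?_)
    (hJm.trans (jacobson_eq_maximalIdeal ⊥ bot_ne_top).ge))
  obtain ⟨a, ha, b, hb, rfl⟩ := Submodule.mem_sup.1 (hsq ▸ h hx)
  have ha0 : a ∈ I ⊓ J :=
    ⟨Ideal.mul_le_left ha, (Submodule.add_mem_iff_left _ (Ideal.mul_le_left hb)).1 hx⟩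
  rw [hdisj, Submodule.mem_bot] at ha0
  simpa [ha0] using hb

/-- The coordinates of a vector in `I • Rⁿ` lie in `I`. -/
theorem apply_mem_of_mem_smul_top {R ι : Type*} [CommRing R] {I : Ideal R} {x : ι → R}
    (hx : x ∈ I • (⊤ : Submodule R (ι → R))) (i : ι) : x i ∈ I :=
  Submodule.smul_induction_on hx (fun _ hr _ _ ↦ Ideal.mul_mem_right _ _ hr)
    fun _ _ ↦ I.add_mem

/-- The projection onto the first summand of a decomposition of an ideal. -/
theorem exists_projection {R : Type u} [CommRing R] {I J K : Ideal R}
    (hdisj : I ⊓ J = ⊥) (hsum : I ⊔ J = K) :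
    ∃ f : K →ₗ[R] R, (∀ x, f x ∈ I) ∧ (∀ x : K, (x : R) - f x ∈ J) ∧
      (∀ x : K, (x : R) ∈ I → f x = x) ∧ ∀ x : K, (x : R) ∈ J → f x = 0 := by
  subst hsum
  have hc : IsCompl (I.submoduleOf (I ⊔ J)) (J.submoduleOf (I ⊔ J)) := by
    constructor
    · rw [disjoint_iff, eq_bot_iff]
      rintro x ⟨hx, hx'⟩
      have : (x : R) ∈ I ⊓ J := ⟨hx, hx'⟩
      rw [hdisj, Submodule.mem_bot] at this
      exact Subtype.ext this
    · rw [codisjoint_iff, eq_top_iff]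
      rintro ⟨x, hx⟩ -
      obtain ⟨a, ha, b, hb, rfl⟩ := Submodule.mem_sup.1 hx
      exact Submodule.mem_sup.2 ⟨⟨a, Submodule.mem_sup_left ha⟩, ha,
        ⟨b, Submodule.mem_sup_right hb⟩, hb, rfl⟩
  let f : ↥(I ⊔ J) →ₗ[R] R := (I ⊔ J).subtype ∘ₗ Submodule.projection _ _ hc
  have hf (x : ↥(I ⊔ J)) (hx : (x : R) ∈ I) : f x = x :=
    congrArg Subtype.val (Submodule.projection_apply_left hc ⟨x, hx⟩)
  have hf' (x : ↥(I ⊔ J)) (hx : (x : R) ∈ J) : f x = 0 :=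
    congrArg Subtype.val ((Submodule.projection_apply_eq_zero_iff hc).2 hx)
  refine ⟨f, fun ⟨x, hx⟩ ↦ ?_, fun ⟨x, hx⟩ ↦ ?_, hf, hf'⟩ <;>
  · obtain ⟨a, ha, b, hb, rfl⟩ := Submodule.mem_sup.1 hx
    have : f ⟨a + b, hx⟩ = a := by
      rw [show (⟨a + b, hx⟩ : ↥(I ⊔ J)) = ⟨a, Submodule.mem_sup_left ha⟩ +
        ⟨b, Submodule.mem_sup_right hb⟩ from rfl, map_add, hf _ ha, hf' _ hb, add_zero]
    simpa [this]

namespace MinFreeRes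

open IsLocalRing

/-- If `𝔪 = I ⊕ J` with `J ≠ 0`, then there is a vector `v` with a unit coordinate such that
`I • v` lies in the second syzygy of the residue field. -/
theorem exists_smul_mem_range {R : Type u} [CommRing R] [IsNoetherianRing R] [IsLocalRing R]
    (F : MinFreeRes R (maximalIdeal R) (ResidueField R))
    {I J : Ideal R} (hJ : J ≠ ⊥) (hdisj : I ⊓ J = ⊥) (hsum : I ⊔ J = maximalIdeal R) :
    ∃ (v : Fin (F.b 1) → R) (l : Fin (F.b 1)) (u : R), u * v l = 1 ∧
      ∀ s ∈ I, s • v ∈ LinearMap.range (F.d 1) := by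
  obtain ⟨j, hj, hjm⟩ := SetLike.not_le_iff_exists.1 (not_le_maximalIdeal_sq hJ hdisj hsum)
  obtain ⟨e, he⟩ := F.aug_surj 1
  have hje : j • e ∈ LinearMap.range (F.d 0) := by
    rw [F.exact_aug, LinearMap.mem_ker, map_smul, he, Algebra.smul_def, mul_one]
    exact (residue_eq_zero_iff j).2 (hsum ▸ Submodule.mem_sup_right hj)
  obtain ⟨v, hv⟩ := hje
  have hunit : ∃ l, IsUnit (v l) := by
    by_contra! h
    have hdv : ∀ i, F.d 0 v i ∈ maximalIdeal R * maximalIdeal R := by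
      intro i
      rw [LinearMap.pi_apply_eq_sum_univ (F.d 0) v, Finset.sum_apply]
      refine Submodule.sum_mem _ fun k _ ↦ Ideal.mul_mem_mul (h k) ?_
      exact apply_mem_of_mem_smul_top (F.minimal 0 ⟨_, rfl⟩) i
    have heu : ∃ i, IsUnit (e i) := by
      by_contra! h'
      have : F.aug e = 0 := by
        rw [LinearMap.pi_apply_eq_sum_univ F.aug e]
        refine Finset.sum_eq_zero fun k _ ↦ ?_
        rw [Algebra.smul_def]
        exact mul_eq_zero_of_left ((residue_eq_zero_iff _).2 (h' k)) _
      exact one_ne_zero (he.symm.trans this)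
    obtain ⟨i, hi⟩ := heu
    refine hjm ((Ideal.mul_unit_mem_iff_mem _ hi).1 ?_)
    have := hdv i
    rwa [hv] at this
  obtain ⟨l, hl⟩ := hunit
  obtain ⟨u, hu⟩ := hl.exists_left_inv
  refine ⟨v, l, u, hu, fun s hs ↦ ?_⟩
  have hsj : s * j ∈ I ⊓ J := Ideal.mul_le_inf (Ideal.mul_mem_mul hs hj)
  rw [hdisj, Submodule.mem_bot] at hsj
  rw [F.exact, LinearMap.mem_ker, map_smul, hv, smul_smul, hsj, zero_smul]

end MinFreeRes

/-- if the maximal ideal `𝔪` is decomposable, i.e. `𝔪 = I ⊕ J` for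
nonzero ideals `I, J`, then `𝔪` is a direct summand of `Ω_R²(k)`. -/
theorem stmt6 (R : Type u) [CommRing R] [IsNoetherianRing R] [IsLocalRing R]
    (I J : Ideal R) (hI : I ≠ ⊥) (hJ : J ≠ ⊥)
    (hdisj : I ⊓ J = ⊥) (hsum : I ⊔ J = IsLocalRing.maximalIdeal R) :
    ∀ F : MinFreeRes R (IsLocalRing.maximalIdeal R) (IsLocalRing.ResidueField R),
      IsDirectSummand R ↥(IsLocalRing.maximalIdeal R) (F.Syz 2) := by
  intro F
  obtain ⟨f, hfI, hfJ, hf, hf'⟩ := exists_projection hdisj hsum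
  obtain ⟨v, l, u, hu, hv⟩ := F.exists_smul_mem_range hJ hdisj hsum
  obtain ⟨w, k, t, ht, hw⟩ := F.exists_smul_mem_range hI (inf_comm I J ▸ hdisj)
    (sup_comm I J ▸ hsum)
  have hIm : I ≤ IsLocalRing.maximalIdeal R := hsum ▸ le_sup_left
  have hJm : J ≤ IsLocalRing.maximalIdeal R := hsum ▸ le_sup_right
  let g := (IsLocalRing.maximalIdeal R).subtype - f
  have hgJ (x) : g x ∈ J := hfJ x
  have hmem (x : LinearMap.range (F.d 1)) (i) : (x : Fin (F.b 1) → R) i ∈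
      IsLocalRing.maximalIdeal R :=
    apply_mem_of_mem_smul_top (F.minimal 1 x.2) i
  let c (i) : LinearMap.range (F.d 1) →ₗ[R] IsLocalRing.maximalIdeal R :=
    (LinearMap.proj i ∘ₗ (LinearMap.range (F.d 1)).subtype).codRestrict _ (hmem · i)
  let ι : IsLocalRing.maximalIdeal R →ₗ[R] LinearMap.range (F.d 1) :=
    (f.smulRight v + g.smulRight w).codRestrict _
      fun x ↦ add_mem (hv _ (hfI x)) (hw _ (hgJ x))
  let p : LinearMap.range (F.d 1) →ₗ[R] IsLocalRing.maximalIdeal R :=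
    (u • f ∘ₗ c l + t • g ∘ₗ c k).codRestrict _ fun x ↦
      add_mem (Ideal.mul_mem_left _ _ (hIm (hfI _))) (Ideal.mul_mem_left _ _ (hJm (hgJ _)))
  refine ⟨ι, p, LinearMap.ext fun x ↦ Subtype.ext ?_⟩
  let a : IsLocalRing.maximalIdeal R := ⟨f x, hIm (hfI x)⟩
  let b : IsLocalRing.maximalIdeal R := ⟨g x, hJm (hgJ x)⟩
  have hfa : f a = f x := hf a (hfI x)
  have hfb : f b = 0 := hf' b (hgJ x)
  have hga : g a = 0 := sub_eq_zero.2 hfa.symm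
  have hgb : g b = g x := by
    change g x - f b = g x
    rw [hfb, sub_zero]
  have hc (i) : c i (ι x) = v i • a + w i • b := by
    refine Subtype.ext ?_
    change f x * v i + g x * w i = v i * f x + w i * g x
    ring
  have hfc (i) : f (c i (ι x)) = v i * f x := by
    rw [hc, map_add, map_smul, map_smul, hfa, hfb, smul_zero, add_zero, smul_eq_mul]
  have hgc (i) : g (c i (ι x)) = w i * g x := by
    rw [hc, map_add, map_smul, map_smul, hga, hgb, smul_zero, zero_add, smul_eq_mul]
  change u * f (c l (ι x)) + t * g (c k (ι x)) = x
  rw [hfc, hgc, ← mul_assoc, ← mul_assoc, hu, ht]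
  simp [g]
end

section
/- Let k be a field and R = k[x,y]/(x³, x²y, y²), an artinian local ring with maximal ideal m = (x,y). Then m is not a decomposable R-module, but m (which equals Ω¹(k)) is a direct summand of the second syzygy Ω²(k) of the residue field. -/
universe u

/-- `R` is the ring `k[x,y]/(x³, x²y, y²)`, presented by coordinates: the relations hold and
`1, x, y, x², xy` is a `k`-basis, where `k` acts through `ι`. -/
structure HasMonomialBasis {k R : Type*} [Field k] [CommRing R] (ι : k →+* R) (x y : R) :
    Prop where
  x_cube : x ^ 3 = 0
  x_sq_mul_y : x ^ 2 * y = 0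
  y_sq : y ^ 2 = 0
  span : ∀ r : R, ∃ c₀ c₁ c₂ c₃ c₄ : k,
    r = ι c₀ + ι c₁ * x + ι c₂ * y + ι c₃ * x ^ 2 + ι c₄ * (x * y)
  indep : ∀ c₀ c₁ c₂ c₃ c₄ : k,
    ι c₀ + ι c₁ * x + ι c₂ * y + ι c₃ * x ^ 2 + ι c₄ * (x * y) = 0 →
    c₀ = 0 ∧ c₁ = 0 ∧ c₂ = 0 ∧ c₃ = 0 ∧ c₄ = 0

namespace HasMonomialBasis

variable {k R : Type*} [Field k] [CommRing R] {ι : k →+* R} {x y : R}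

theorem isArtinianRing (h : HasMonomialBasis ι x y) : IsArtinianRing R := by
  classical
  let _ := ι.toAlgebra
  have : Module.Finite k R := by
    refine ⟨⟨{1, x, y, x ^ 2, x * y}, ?_⟩⟩
    rw [eq_top_iff]
    rintro r -
    obtain ⟨c₀, c₁, c₂, c₃, c₄, rfl⟩ := h.span r
    have key : ∀ (c : k) (z : R), z ∈ ({1, x, y, x ^ 2, x * y} : Set R) →
        ι c * z ∈ Submodule.span k ({1, x, y, x ^ 2, x * y} : Set R) := fun c z hz => by
      have := Submodule.smul_mem _ c (Submodule.subset_span (R := k) hz)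
      rwa [Algebra.smul_def] at this
    have h₀ := key c₀ 1 (by simp)
    rw [mul_one] at h₀
    simp only [Finset.coe_insert, Finset.coe_singleton]
    exact add_mem (add_mem (add_mem (add_mem h₀ (key _ x (by simp)))
      (key _ y (by simp))) (key _ (x ^ 2) (by simp))) (key _ (x * y) (by simp))
  exact IsArtinianRing.of_finite k R

theorem mem_iff (h : HasMonomialBasis ι x y) (r : R) :
    r ∈ Ideal.span {x, y} ↔ ∃ c₁ c₂ c₃ c₄ : k,
      r = ι c₁ * x + ι c₂ * y + ι c₃ * x ^ 2 + ι c₄ * (x * y) := by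
  rw [Ideal.mem_span_pair]
  constructor
  · rintro ⟨a, b, rfl⟩
    obtain ⟨a₀, a₁, a₂, a₃, a₄, rfl⟩ := h.span a
    obtain ⟨b₀, b₁, b₂, b₃, b₄, rfl⟩ := h.span b
    refine ⟨a₀, b₀, a₁, a₂ + b₁, ?_⟩
    simp only [map_add]
    linear_combination ι a₃ * h.x_cube + (ι a₄ + ι b₃) * h.x_sq_mul_y +
      (ι b₂ + ι b₄ * x) * h.y_sq
  · rintro ⟨c₁, c₂, c₃, c₄, rfl⟩
    exact ⟨ι c₁ + ι c₃ * x + ι c₄ * y, ι c₂, by ring⟩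

theorem mem_mul_self (h : HasMonomialBasis ι x y) {r : R}
    (hr : r ∈ Ideal.span {x, y} * Ideal.span {x, y}) :
    ∃ c₃ c₄ : k, r = ι c₃ * x ^ 2 + ι c₄ * (x * y) := by
  induction hr using Submodule.mul_induction_on' with
  | mem_mul_mem a ha b hb =>
    obtain ⟨a₁, a₂, a₃, a₄, rfl⟩ := (h.mem_iff a).1 ha
    obtain ⟨b₁, b₂, b₃, b₄, rfl⟩ := (h.mem_iff b).1 hb
    refine ⟨a₁ * b₁, a₁ * b₂ + a₂ * b₁, ?_⟩
    simp only [map_add, map_mul]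
    linear_combination (ι a₁ * ι b₃ + ι a₃ * ι b₁ + ι a₃ * ι b₃ * x) * h.x_cube +
      (ι a₁ * ι b₄ + ι a₄ * ι b₁ + ι a₂ * ι b₃ + ι a₃ * ι b₂ +
        (ι a₃ * ι b₄ + ι a₄ * ι b₃) * x + ι a₄ * ι b₄ * y) * h.x_sq_mul_y +
      (ι a₂ * ι b₂ + (ι a₂ * ι b₄ + ι a₄ * ι b₂) * x) * h.y_sq
  | add a _ b _ ha hb =>
    obtain ⟨a₃, a₄, rfl⟩ := ha
    obtain ⟨b₃, b₄, rfl⟩ := hb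
    exact ⟨a₃ + b₃, a₄ + b₄, by simp only [map_add]; ring⟩

theorem x_notMem (h : HasMonomialBasis ι x y) :
    x ∉ Ideal.span {x, y} * Ideal.span {x, y} := by
  intro hx
  obtain ⟨c₃, c₄, e⟩ := h.mem_mul_self hx
  have := h.indep 0 1 0 (-c₃) (-c₄) (by simp only [map_zero, map_one, map_neg]; linear_combination e)
  simp at this

theorem y_sub_notMem (h : HasMonomialBasis ι x y) (w : R) :
    y - w * x ∉ Ideal.span {x, y} * Ideal.span {x, y} := by
  intro hy
  obtain ⟨c₃, c₄, e⟩ := h.mem_mul_self hy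
  obtain ⟨w₀, w₁, w₂, w₃, w₄, rfl⟩ := h.span w
  have := h.indep 0 (-w₀) 1 (-w₁ - c₃) (-w₂ - c₄) (by
    simp only [map_zero, map_one, map_neg, map_sub]
    linear_combination e + ι w₃ * h.x_cube + ι w₄ * h.x_sq_mul_y)
  simp at this

theorem one_notMem (h : HasMonomialBasis ι x y) : (1 : R) ∉ Ideal.span {x, y} := by
  intro h₁
  obtain ⟨c₁, c₂, c₃, c₄, e⟩ := (h.mem_iff 1).1 h₁
  have := h.indep 1 (-c₁) (-c₂) (-c₃) (-c₄) (by
    simp only [map_one, map_neg]; linear_combination e)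
  simp at this

theorem isMaximal (h : HasMonomialBasis ι x y) : (Ideal.span {x, y}).IsMaximal := by
  rw [Ideal.isMaximal_iff]
  refine ⟨h.one_notMem, fun J r hJ hr hrJ => ?_⟩
  obtain ⟨c₀, c₁, c₂, c₃, c₄, rfl⟩ := h.span r
  have hm : ι c₁ * x + ι c₂ * y + ι c₃ * x ^ 2 + ι c₄ * (x * y) ∈ Ideal.span {x, y} :=
    (h.mem_iff _).2 ⟨_, _, _, _, rfl⟩
  have hc : c₀ ≠ 0 := by
    rintro rfl
    exact hr (by simpa using hm)
  have := J.mul_mem_left (ι c₀⁻¹) (J.sub_mem hrJ (hJ hm))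
  convert this using 1
  have hu : ι c₀⁻¹ * ι c₀ = 1 := by rw [← map_mul, inv_mul_cancel₀ hc, map_one]
  linear_combination -hu

theorem isMaximal_iff (h : HasMonomialBasis ι x y) (N : Ideal R) :
    N.IsMaximal ↔ N = Ideal.span {x, y} := by
  constructor
  · intro hN
    refine (h.isMaximal.eq_of_le hN.ne_top ?_).symm
    rw [Ideal.span_le, Set.insert_subset_iff, Set.singleton_subset_iff]
    exact ⟨hN.isPrime.mem_of_pow_mem 3 (by simp [h.x_cube]),
      hN.isPrime.mem_of_pow_mem 2 (by simp [h.y_sq])⟩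
  · rintro rfl
    exact h.isMaximal

theorem isUnit_of_notMem (h : HasMonomialBasis ι x y) {r : R} (hr : r ∉ Ideal.span {x, y}) :
    IsUnit r := by
  by_contra hu
  obtain ⟨N, hN, hrN⟩ := exists_max_ideal_of_mem_nonunits hu
  exact hr ((h.isMaximal_iff N).1 hN ▸ hrN)

/-- A submodule of `𝔪` containing an element with nonzero `x`-coefficient contains `𝔪²`. -/
theorem sq_mem_of_coeff_ne_zero (h : HasMonomialBasis ι x y)
    (A : Submodule R (Ideal.span {x, y})) {α : Ideal.span {x, y}} (hα : α ∈ A)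
    {a₁ a₂ a₃ a₄ : k} (ha : (α : R) = ι a₁ * x + ι a₂ * y + ι a₃ * x ^ 2 + ι a₄ * (x * y))
    (ha₁ : a₁ ≠ 0) {z : Ideal.span {x, y}} {c₃ c₄ : k}
    (hz : (z : R) = ι c₃ * x ^ 2 + ι c₄ * (x * y)) : z ∈ A := by
  have : z = (ι (c₃ / a₁) * x + ι ((c₄ - c₃ / a₁ * a₂) / a₁) * y) • α := by
    apply Subtype.ext
    rw [Submodule.coe_smul, smul_eq_mul, ha, hz]
    have e₁ : ι (c₃ / a₁) * ι a₁ = ι c₃ := by rw [← map_mul, div_mul_cancel₀ _ ha₁]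
    have e₂ : ι ((c₄ - c₃ / a₁ * a₂) / a₁) * ι a₁ = ι c₄ - ι (c₃ / a₁) * ι a₂ := by
      rw [← map_mul, div_mul_cancel₀ _ ha₁, map_sub, map_mul]
    generalize ι (c₃ / a₁) = p at *
    generalize ι ((c₄ - c₃ / a₁ * a₂) / a₁) = q at *
    linear_combination (-x ^ 2) * e₁ - x * y * e₂ - p * ι a₃ * h.x_cube -
      (p * ι a₄ + q * ι a₃) * h.x_sq_mul_y - (q * ι a₂ + q * ι a₄ * x) * h.y_sq
  rw [this]
  exact A.smul_mem _ hα

theorem exists_sq_mem (h : HasMonomialBasis ι x y)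
    (B : Submodule R (Ideal.span {x, y})) (hB : B ≠ ⊥) :
    ∃ z ∈ B, z ≠ 0 ∧ ∃ c₃ c₄ : k, (z : R) = ι c₃ * x ^ 2 + ι c₄ * (x * y) := by
  obtain ⟨b, hb, hb₀⟩ := B.ne_bot_iff.1 hB
  obtain ⟨b₁, b₂, b₃, b₄, e⟩ := (h.mem_iff _).1 b.2
  have hxb : ((x • b : Ideal.span {x, y}) : R) = ι b₁ * x ^ 2 + ι b₂ * (x * y) := by
    rw [Submodule.coe_smul, smul_eq_mul, e]
    linear_combination ι b₃ * h.x_cube + ι b₄ * h.x_sq_mul_y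
  by_cases hx : x • b = 0
  · rw [hx, Submodule.coe_zero] at hxb
    obtain ⟨-, -, -, rfl, rfl⟩ := h.indep 0 0 0 b₁ b₂ (by
      simp only [map_zero]; linear_combination -hxb)
    exact ⟨b, hb, hb₀, b₃, b₄, by rw [e]; simp⟩
  · exact ⟨x • b, B.smul_mem _ hb, hx, b₁, b₂, hxb⟩

theorem not_decomposable (h : HasMonomialBasis ι x y) :
    ¬ (∃ A B : Submodule R (Ideal.span {x, y}),
        A ≠ ⊥ ∧ B ≠ ⊥ ∧ A ⊓ B = ⊥ ∧ A ⊔ B = ⊤) := by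
  rintro ⟨A, B, hA, hB, hAB, hsup⟩
  have hxm : x ∈ Ideal.span {x, y} := Ideal.subset_span (by simp)
  have hx : (⟨x, hxm⟩ : Ideal.span {x, y}) ∈ A ⊔ B := hsup ▸ Submodule.mem_top
  obtain ⟨α, hα, β, hβ, e⟩ := Submodule.mem_sup.1 hx
  obtain ⟨a₁, a₂, a₃, a₄, ea⟩ := (h.mem_iff _).1 α.2
  obtain ⟨b₁, b₂, b₃, b₄, eb⟩ := (h.mem_iff _).1 β.2
  have e' : (α : R) + β = x := congrArg Subtype.val e
  rw [ea, eb] at e'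
  have hsum := (h.indep 0 (a₁ + b₁ - 1) (a₂ + b₂) (a₃ + b₃) (a₄ + b₄) (by
    simp only [map_zero, map_add, map_sub, map_one]; linear_combination e')).2.1
  by_cases ha : a₁ = 0
  · have hb : b₁ ≠ 0 := by
      rintro rfl
      simp [ha] at hsum
    obtain ⟨z, hz, hz₀, c₃, c₄, ez⟩ := h.exists_sq_mem A hA
    have : z ∈ A ⊓ B := ⟨hz, h.sq_mem_of_coeff_ne_zero B hβ eb hb ez⟩
    rw [hAB] at this
    exact hz₀ this
  · obtain ⟨z, hz, hz₀, c₃, c₄, ez⟩ := h.exists_sq_mem B hB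
    have : z ∈ A ⊓ B := ⟨h.sq_mem_of_coeff_ne_zero A hα ea ha ez, hz⟩
    rw [hAB] at this
    exact hz₀ this

theorem mul_y_eq_zero (h : HasMonomialBasis ι x y) {a b : R} (hab : a * x + b * y = 0) :
    a * y = 0 := by
  obtain ⟨a₀, a₁, a₂, a₃, a₄, rfl⟩ := h.span a
  obtain ⟨b₀, b₁, b₂, b₃, b₄, rfl⟩ := h.span b
  obtain ⟨-, rfl, -, rfl, -⟩ := h.indep 0 a₀ b₀ a₁ (a₂ + b₁) (by
    simp only [map_zero, map_add]
    linear_combination hab - ι a₃ * h.x_cube - (ι a₄ + ι b₃) * h.x_sq_mul_y -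
      (ι b₂ + ι b₄ * x) * h.y_sq)
  simp only [map_zero]
  linear_combination (ι a₂ + ι a₄ * x) * h.y_sq + ι a₃ * h.x_sq_mul_y

/-- The `R`-linear map `𝔪 → R`, `a x + b y ↦ a y`, is well defined. -/
theorem exists_linearMap (h : HasMonomialBasis ι x y) :
    ∃ θ : Ideal.span {x, y} →ₗ[R] R, ∀ (z : Ideal.span {x, y}) (a b : R),
      a * x + b * y = z → θ z = a * y := by
  have hex : ∀ z : Ideal.span {x, y}, ∃ a b : R, a * x + b * y = z := fun z =>
    Ideal.mem_span_pair.1 z.2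
  choose f g hfg using hex
  have key : ∀ (z : Ideal.span {x, y}) (a b : R), a * x + b * y = z → f z * y = a * y := by
    intro z a b hab
    have := h.mul_y_eq_zero (a := f z - a) (b := g z - b) (by linear_combination hfg z - hab)
    linear_combination this
  refine ⟨{ toFun := fun z => f z * y, map_add' := fun z w => ?_, map_smul' := fun r z => ?_ }, key⟩
  · rw [key (z + w) (f z + f w) (g z + g w), add_mul]
    rw [Submodule.coe_add]
    linear_combination hfg z + hfg w
  · rw [key (r • z) (r * f z) (r * g z), RingHom.id_apply, smul_eq_mul, mul_assoc]
    rw [Submodule.coe_smul, smul_eq_mul]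
    linear_combination r * hfg z

/-- If `φ : Rⁿ → R` has image `𝔪` and `ker φ ⊆ 𝔪 Rⁿ`, then `𝔪` is a direct summand of `ker φ`. -/
theorem exists_retraction_ker (h : HasMonomialBasis ι x y) {n : Type*} [Finite n]
    (φ : (n → R) →ₗ[R] R) (hφ : LinearMap.range φ = Ideal.span {x, y})
    (hker : ∀ f, φ f = 0 → ∀ j, f j ∈ Ideal.span {x, y}) :
    ∃ (i : Ideal.span {x, y} →ₗ[R] LinearMap.ker φ)
      (p : LinearMap.ker φ →ₗ[R] Ideal.span {x, y}), p ∘ₗ i = LinearMap.id := by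
  have := Fintype.ofFinite n
  classical
  have hφmem : ∀ f, φ f ∈ Ideal.span {x, y} := fun f => hφ ▸ LinearMap.mem_range_self φ f
  have hφsq : ∀ f : n → R, (∀ j, f j ∈ Ideal.span {x, y}) →
      φ f ∈ Ideal.span {x, y} * Ideal.span {x, y} := by
    intro f hf
    rw [← LinearMap.sum_single_apply (fun _ => R) f, map_sum]
    refine sum_mem fun j _ => ?_
    have : Pi.single j (f j) = f j • (Pi.single j 1 : n → R) := by
      rw [← Pi.single_smul, smul_eq_mul, mul_one]
    rw [this, map_smul, smul_eq_mul]
    exact Ideal.mul_mem_mul (hf j) (hφmem _)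
  obtain ⟨u, hu⟩ : x ∈ LinearMap.range φ := hφ ▸ Ideal.subset_span (by simp)
  obtain ⟨v, hv⟩ : y ∈ LinearMap.range φ := hφ ▸ Ideal.subset_span (by simp)
  obtain ⟨i, hi⟩ : ∃ i, u i ∉ Ideal.span {x, y} := by
    by_contra! hc
    exact h.x_notMem (hu ▸ hφsq u hc)
  obtain ⟨s, hs⟩ := (h.isUnit_of_notMem hi).exists_left_inv
  obtain ⟨j, hj⟩ : ∃ j, (v - (v i * s) • u) j ∉ Ideal.span {x, y} := by
    by_contra! hc
    refine h.y_sub_notMem (v i * s) ?_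
    have := hφsq _ hc
    rwa [map_sub, map_smul, hu, hv, smul_eq_mul] at this
  obtain ⟨t, ht⟩ := (h.isUnit_of_notMem hj).exists_left_inv
  simp only [Pi.sub_apply, Pi.smul_apply, smul_eq_mul] at ht
  let π : (n → R) →ₗ[R] R := t • (LinearMap.proj j - (s * u j) • LinearMap.proj i)
  have hπ : ∀ f, π f = t * (f j - s * u j * f i) := fun f => rfl
  have hπu : π u = 0 := by rw [hπ]; linear_combination -t * u j * hs
  have hπv : π v = 1 := by rw [hπ]; linear_combination ht
  obtain ⟨θ, hθ⟩ := h.exists_linearMap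
  let I : Ideal.span {x, y} →ₗ[R] (n → R) :=
    LinearMap.toSpanSingleton R _ v ∘ₗ Submodule.subtype _ -
      LinearMap.toSpanSingleton R _ u ∘ₗ θ
  have hI : ∀ z, I z = (z : R) • v - θ z • u := fun z => rfl
  refine ⟨I.codRestrict _ fun z => ?_, (π ∘ₗ Submodule.subtype _).codRestrict _ fun f => ?_, ?_⟩
  · obtain ⟨a, b, hab⟩ := Ideal.mem_span_pair.1 z.2
    rw [LinearMap.mem_ker, hI, map_sub, map_smul, map_smul, hu, hv, hθ z a b hab, ← hab,
      smul_eq_mul, smul_eq_mul]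
    linear_combination b * h.y_sq
  · have hf := hker f f.2
    change π f ∈ _
    rw [hπ]
    exact Ideal.mul_mem_left _ _ (Ideal.sub_mem _ (hf j) (Ideal.mul_mem_left _ _ (hf i)))
  · ext z
    change π (I z) = z
    rw [hI, map_sub, map_smul, map_smul, hπu, hπv]
    simp

end HasMonomialBasis

namespace MinFreeRes

variable {R : Type u} [CommRing R] {𝔪 : Ideal R}

theorem apply_mem {M : Type u} [AddCommGroup M] [Module R M] (F : MinFreeRes R 𝔪 M) (n : ℕ)
    {f : Fin (F.b n) → R} (hf : f ∈ LinearMap.range (F.d n)) (j : Fin (F.b n)) : f j ∈ 𝔪 := by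
  replace hf := F.minimal n hf
  induction hf using Submodule.smul_induction_on' with
  | smul r hr g _ => exact 𝔪.mul_mem_right _ hr
  | add f _ g _ hf hg => exact 𝔪.add_mem hf hg

theorem range_d_zero (F : MinFreeRes R 𝔪 (R ⧸ 𝔪)) (f : Fin (F.b 0) → R) :
    f ∈ LinearMap.range (F.d 0) ↔ ∀ j, f j ∈ 𝔪 := by
  refine ⟨F.apply_mem 0, fun hf => ?_⟩
  rw [F.exact_aug, LinearMap.mem_ker, ← LinearMap.sum_single_apply (fun _ => R) f, map_sum]
  refine Finset.sum_eq_zero fun j _ => ?_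
  have : Pi.single j (f j) = f j • (Pi.single j 1 : Fin (F.b 0) → R) := by
    rw [← Pi.single_smul, smul_eq_mul, mul_one]
  rw [this, map_smul]
  obtain ⟨r, hr⟩ := Ideal.Quotient.mk_surjective (F.aug (Pi.single j 1))
  rw [← hr, Algebra.smul_def, Ideal.Quotient.algebraMap_eq, Ideal.Quotient.eq_zero_iff_mem.2 (hf j),
    zero_mul]

theorem nonempty_unique_b_zero (F : MinFreeRes R 𝔪 (R ⧸ 𝔪)) (h𝔪 : 𝔪 ≠ ⊤) :
    Nonempty (Unique (Fin (F.b 0))) := by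
  have : Nontrivial (R ⧸ 𝔪) := Ideal.Quotient.nontrivial_iff.2 h𝔪
  rw [unique_iff_subsingleton_and_nonempty]
  constructor
  · refine ⟨fun i j => ?_⟩
    by_contra hij
    obtain ⟨r, hr⟩ := Ideal.Quotient.mk_surjective (F.aug (Pi.single i 1))
    obtain ⟨s, hs⟩ := Ideal.Quotient.mk_surjective (F.aug (Pi.single j 1))
    have hmem : s • (Pi.single i 1 : Fin (F.b 0) → R) - r • (Pi.single j 1 : Fin (F.b 0) → R) ∈
        LinearMap.range (F.d 0) := by
      rw [F.exact_aug, LinearMap.mem_ker, map_sub, map_smul, map_smul, ← hr, ← hs,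
        Algebra.smul_def, Algebra.smul_def, Ideal.Quotient.algebraMap_eq, mul_comm, sub_self]
    have hr𝔪 : r ∈ 𝔪 := by
      have := F.apply_mem 0 hmem j
      simpa [Pi.single_apply, Ne.symm hij] using this
    have hi : (Pi.single i 1 : Fin (F.b 0) → R) ∈ LinearMap.range (F.d 0) := by
      rw [F.exact_aug, LinearMap.mem_ker, ← hr]
      exact Ideal.Quotient.eq_zero_iff_mem.2 hr𝔪
    have := F.apply_mem 0 hi i
    rw [Pi.single_eq_same] at this
    exact h𝔪 ((Ideal.eq_top_iff_one _).2 this)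
  · by_contra hne
    rw [not_nonempty_iff] at hne
    have := F.aug_surj.subsingleton
    exact not_subsingleton (R ⧸ 𝔪) this

/-- The first syzygy of `R ⧸ 𝔪` is `𝔪`. -/
theorem nonempty_syz_one_equiv (F : MinFreeRes R 𝔪 (R ⧸ 𝔪)) (h𝔪 : 𝔪 ≠ ⊤) :
    Nonempty (F.Syz 1 ≃ₗ[R] 𝔪) := by
  obtain ⟨hu⟩ := F.nonempty_unique_b_zero h𝔪
  let ψ : LinearMap.range (F.d 0) →ₗ[R] 𝔪 :=
    (LinearMap.proj (R := R) (φ := fun _ => R) (default : Fin (F.b 0)) ∘ₗ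
      Submodule.subtype _).codRestrict 𝔪 fun f => (F.range_d_zero f).1 f.2 _
  refine ⟨LinearEquiv.ofBijective (M := LinearMap.range (F.d 0)) ψ ⟨fun f g hfg => ?_, fun z => ?_⟩⟩
  · have : f.1 default = g.1 default := congrArg Subtype.val hfg
    refine Subtype.ext (funext fun j => ?_)
    rwa [Unique.eq_default j]
  · exact ⟨⟨fun _ => z, (F.range_d_zero _).2 fun _ => z.2⟩, rfl⟩

end MinFreeRes

theorem HasMonomialBasis.isDirectSummand_syz_two {k : Type*} [Field k] {R : Type u} [CommRing R]
    {ι : k →+* R} {x y : R} (h : HasMonomialBasis ι x y)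
    (F : MinFreeRes R (Ideal.span {x, y}) (R ⧸ Ideal.span {x, y})) :
    IsDirectSummand R (Ideal.span {x, y}) (F.Syz 2) := by
  obtain ⟨hu⟩ := F.nonempty_unique_b_zero h.isMaximal.ne_top
  let φ : (Fin (F.b 1) → R) →ₗ[R] R :=
    LinearMap.proj (R := R) (φ := fun _ => R) (default : Fin (F.b 0)) ∘ₗ F.d 0
  have hker : LinearMap.ker φ = LinearMap.range (F.d 1) := by
    rw [F.exact 0]
    ext f
    rw [LinearMap.mem_ker, LinearMap.mem_ker]
    refine ⟨fun hf => funext fun j => ?_, fun hf => congrFun hf default⟩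
    rw [Unique.eq_default j]
    exact hf
  have hrange : LinearMap.range φ = Ideal.span {x, y} := by
    ext z
    constructor
    · rintro ⟨f, rfl⟩
      exact F.apply_mem 0 (LinearMap.mem_range_self _ f) default
    · intro hz
      obtain ⟨f, hf⟩ := (F.range_d_zero (fun _ => z)).2 fun _ => hz
      exact ⟨f, congrFun hf default⟩
  have hsplit := h.exists_retraction_ker φ hrange fun f hf j =>
    F.apply_mem 1 (hker ▸ LinearMap.mem_ker.2 hf) j
  rw [hker] at hsplit
  exact hsplit

section Presentation

open MvPolynomial

theorem coeff_eq_zero_of_mem_monomial_span {k : Type*} [CommRing k] {p : MvPolynomial (Fin 2) k}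
    (hp : p ∈ Ideal.span {(X 0 : MvPolynomial (Fin 2) k) ^ 3, X 0 ^ 2 * X 1, X 1 ^ 2})
    (m : Fin 2 →₀ ℕ) (h₁ : m 0 < 3) (h₂ : m 0 < 2 ∨ m 1 < 1) (h₃ : m 1 < 2) :
    coeff m p = 0 := by
  have hset : ({(X 0 : MvPolynomial (Fin 2) k) ^ 3, X 0 ^ 2 * X 1, X 1 ^ 2} :
      Set (MvPolynomial (Fin 2) k)) = (fun s => monomial s (1 : k)) ''
      {Finsupp.single 0 3, Finsupp.single 0 2 + Finsupp.single 1 1, Finsupp.single 1 2} := by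
    simp [Set.image_insert_eq, X, monomial_mul, monomial_pow]
  rw [hset, mem_ideal_span_monomial_image] at hp
  by_contra hm
  obtain ⟨s, hs, hsm⟩ := hp m (mem_support_iff.2 hm)
  have l₀ := hsm 0
  have l₁ := hsm 1
  rcases hs with rfl | rfl | rfl <;> simp at l₀ l₁ <;> omega

theorem hasMonomialBasis_quotient (k : Type*) [Field k] :
    HasMonomialBasis
      ((Ideal.Quotient.mk (Ideal.span
        {(X 0 : MvPolynomial (Fin 2) k) ^ 3, X 0 ^ 2 * X 1, X 1 ^ 2})).comp C)
      (Ideal.Quotient.mk _ (X 0)) (Ideal.Quotient.mk _ (X 1)) := by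
  set I := Ideal.span {(X 0 : MvPolynomial (Fin 2) k) ^ 3, X 0 ^ 2 * X 1, X 1 ^ 2}
  have h₁ : (Ideal.Quotient.mk I (X 0)) ^ 3 = 0 := by
    rw [← map_pow, Ideal.Quotient.eq_zero_iff_mem]
    exact Ideal.subset_span (by simp)
  have h₂ : (Ideal.Quotient.mk I (X 0)) ^ 2 * Ideal.Quotient.mk I (X 1) = 0 := by
    rw [← map_pow, ← map_mul, Ideal.Quotient.eq_zero_iff_mem]
    exact Ideal.subset_span (by simp)
  have h₃ : (Ideal.Quotient.mk I (X 1)) ^ 2 = 0 := by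
    rw [← map_pow, Ideal.Quotient.eq_zero_iff_mem]
    exact Ideal.subset_span (by simp)
  refine ⟨h₁, h₂, h₃, fun r => ?_, fun c₀ c₁ c₂ c₃ c₄ hc => ?_⟩
  · obtain ⟨p, rfl⟩ := Ideal.Quotient.mk_surjective r
    induction p using MvPolynomial.induction_on with
    | C a => exact ⟨a, 0, 0, 0, 0, by simp⟩
    | add p q hp hq =>
      obtain ⟨a₀, a₁, a₂, a₃, a₄, ha⟩ := hp
      obtain ⟨b₀, b₁, b₂, b₃, b₄, hb⟩ := hq
      refine ⟨a₀ + b₀, a₁ + b₁, a₂ + b₂, a₃ + b₃, a₄ + b₄, ?_⟩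
      rw [map_add, ha, hb]
      simp only [map_add]
      ring
    | mul_X p i hp =>
      obtain ⟨a₀, a₁, a₂, a₃, a₄, ha⟩ := hp
      rw [map_mul, ha]
      fin_cases i
      · refine ⟨0, a₀, 0, a₁, a₂, ?_⟩
        simp only [map_zero, Fin.zero_eta]
        linear_combination ((Ideal.Quotient.mk I).comp C) a₃ * h₁ +
          ((Ideal.Quotient.mk I).comp C) a₄ * h₂
      · refine ⟨0, 0, a₀, 0, a₁, ?_⟩
        simp only [map_zero, Fin.mk_one]
        linear_combination ((Ideal.Quotient.mk I).comp C) a₃ * h₂ +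
          (((Ideal.Quotient.mk I).comp C) a₂ +
            ((Ideal.Quotient.mk I).comp C) a₄ * Ideal.Quotient.mk I (X 0)) * h₃
  · simp only [RingHom.comp_apply, ← map_mul, ← map_pow, ← map_add] at hc
    rw [Ideal.Quotient.eq_zero_iff_mem] at hc
    have hp : C c₀ + C c₁ * X 0 + C c₂ * X 1 + C c₃ * X 0 ^ 2 + C c₄ * (X 0 * X 1) =
        monomial 0 c₀ + monomial (Finsupp.single 0 1) c₁ + monomial (Finsupp.single 1 1) c₂ +
        monomial (Finsupp.single 0 2) c₃ +
        monomial (Finsupp.single 0 1 + Finsupp.single (1 : Fin 2) 1) c₄ := by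
      simp [X, monomial_mul, monomial_pow, C_mul_monomial]
    rw [hp] at hc
    have key := coeff_eq_zero_of_mem_monomial_span hc
    have k₀ := key 0 (by simp) (by simp) (by simp)
    have k₁ := key (Finsupp.single 0 1) (by simp) (by simp) (by simp)
    have k₂ := key (Finsupp.single 1 1) (by simp) (by simp) (by simp)
    have k₃ := key (Finsupp.single 0 2) (by simp) (by simp) (by simp)
    have k₄ := key (Finsupp.single 0 1 + Finsupp.single 1 1) (by simp) (by simp) (by simp)
    simp [coeff_monomial, Finsupp.ext_iff, Fin.forall_fin_two] at k₀ k₁ k₂ k₃ k₄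
    exact ⟨k₀, k₁, k₂, k₃, k₄⟩

end Presentation

theorem HasMonomialBasis.of_ringEquiv {k R S : Type*} [Field k] [CommRing R] [CommRing S]
    {ι : k →+* S} {x y : R} (e : R ≃+* S) (h : HasMonomialBasis ι (e x) (e y)) :
    HasMonomialBasis ((e.symm : S →+* R).comp ι) x y where
  x_cube := e.injective (by simpa using h.x_cube)
  x_sq_mul_y := e.injective (by simpa using h.x_sq_mul_y)
  y_sq := e.injective (by simpa using h.y_sq)
  span r := by
    obtain ⟨c₀, c₁, c₂, c₃, c₄, hr⟩ := h.span (e r)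
    exact ⟨c₀, c₁, c₂, c₃, c₄, e.injective (by simpa using hr)⟩
  indep c₀ c₁ c₂ c₃ c₄ hc := h.indep c₀ c₁ c₂ c₃ c₄ (by simpa using congrArg e hc)

set_option maxHeartbeats 1000000 in
set_option synthInstance.maxHeartbeats 400000 in
open MvPolynomial in
/-- for `R = k[x,y]/(x³, x²y, y²)`, the ring `R` is artinian local
with maximal ideal `𝔪 = (x, y)`; `𝔪` is not decomposable, `𝔪 = Ω¹(k)`, and `𝔪`
is a direct summand of `Ω²(k)`. -/
theorem stmt7 (k : Type u) [Field k]
    (R : Type u) [CommRing R]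
    (e : R ≃+* (MvPolynomial (Fin 2) k ⧸
      Ideal.span {(X 0 : MvPolynomial (Fin 2) k) ^ 3, X 0 ^ 2 * X 1, X 1 ^ 2}))
    (x y : R)
    (hx : e x = Ideal.Quotient.mk _ (X 0))
    (hy : e y = Ideal.Quotient.mk _ (X 1)) :
    IsArtinianRing R ∧
    (∀ N : Ideal R, N.IsMaximal ↔ N = Ideal.span {x, y}) ∧
    ¬ (∃ A B : Submodule R ↥(Ideal.span {x, y}),
        A ≠ ⊥ ∧ B ≠ ⊥ ∧ A ⊓ B = ⊥ ∧ A ⊔ B = ⊤) ∧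
    (∀ F : MinFreeRes R (Ideal.span {x, y}) (R ⧸ Ideal.span {x, y}),
      Nonempty (F.Syz 1 ≃ₗ[R] ↥(Ideal.span {x, y})) ∧
      IsDirectSummand R ↥(Ideal.span {x, y}) (F.Syz 2)) := by
  have h := HasMonomialBasis.of_ringEquiv e (x := x) (y := y)
    (hx ▸ hy ▸ hasMonomialBasis_quotient k)
  exact ⟨h.isArtinianRing, h.isMaximal_iff, h.not_decomposable, fun F =>
    ⟨F.nonempty_syz_one_equiv h.isMaximal.ne_top, h.isDirectSummand_syz_two F⟩⟩
end

section
/- Let (R, m) be a commutative noetherian local ring with m = I ⊕ J for nonzero ideals I, J, and let M be a finitely generated R-module with projective dimension at least two (hence infinite). Then m is a direct summand of Ω_R³(M) ⊕ Ω_R⁴(M). -/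
universe u

section DecomposableMaximalIdeal

open IsLocalRing

variable {R : Type u} [CommRing R]

lemma Submodule.apply_mem_of_mem_smul_top_pi {n : ℕ} {I : Ideal R} {v : Fin n → R}
    (hv : v ∈ I • (⊤ : Submodule R (Fin n → R))) (i : Fin n) : v i ∈ I := by
  refine Submodule.smul_induction_on hv (fun r hr w _ => ?_) (fun x y hx hy => ?_)
  · exact I.mul_mem_right _ hr
  · exact I.add_mem hx hy

lemma Submodule.mem_smul_top_pi_of_forall {n : ℕ} {I : Ideal R} {v : Fin n → R}
    (hv : ∀ i, v i ∈ I) : v ∈ I • (⊤ : Submodule R (Fin n → R)) := by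
  rw [pi_eq_sum_univ v]
  exact Submodule.sum_mem _ fun i _ => Submodule.smul_mem_smul (hv i) trivial

lemma Submodule.map_mem_smul_top {A B : Type*} [AddCommGroup A] [Module R A]
    [AddCommGroup B] [Module R B] {I : Ideal R} (f : A →ₗ[R] B) {v : A}
    (hv : v ∈ I • (⊤ : Submodule R A)) : f v ∈ I • (⊤ : Submodule R B) := by
  have h : f v ∈ (I • (⊤ : Submodule R A)).map f := Submodule.mem_map_of_mem hv
  rw [Submodule.map_smul''] at h
  exact Submodule.smul_mono le_rfl le_top h

/-- Projections onto the two factors of an ideal that is an internal direct sum. -/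
lemma Ideal.exists_projections {I J K : Ideal R} (hdisj : I ⊓ J = ⊥) (hsum : I ⊔ J = K) :
    ∃ (p : K →ₗ[R] I) (q : K →ₗ[R] J), ∀ x, (p x : R) + q x = x := by
  let f : (I × J) →ₗ[R] K :=
    (Submodule.inclusion (le_sup_left.trans hsum.le)).coprod
      (Submodule.inclusion (le_sup_right.trans hsum.le))
  have hf (x : I × J) : ((f x : K) : R) = x.1 + x.2 := by simp [f]
  have hinj : Function.Injective f := by
    rw [← LinearMap.ker_eq_bot, LinearMap.ker_eq_bot']
    rintro ⟨a, b⟩ h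
    have h0 : (a : R) + b = 0 := by rw [← hf (a, b), h]; rfl
    have ha : (a : R) ∈ I ⊓ J := ⟨a.2, by
      rw [eq_neg_of_add_eq_zero_left h0]; exact J.neg_mem b.2⟩
    rw [hdisj, Submodule.mem_bot] at ha
    have hb : (b : R) = 0 := by simpa [ha] using h0
    exact Prod.ext (Subtype.ext ha) (Subtype.ext hb)
  have hsurj : Function.Surjective f := by
    rintro ⟨x, hx⟩
    obtain ⟨a, ha, b, hb, hab⟩ := Submodule.mem_sup.1 (hsum ▸ hx)
    exact ⟨(⟨a, ha⟩, ⟨b, hb⟩), Subtype.ext (by rw [hf]; exact hab)⟩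
  let e := LinearEquiv.ofBijective f ⟨hinj, hsurj⟩
  refine ⟨LinearMap.fst R I J ∘ₗ e.symm, LinearMap.snd R I J ∘ₗ e.symm, fun x => ?_⟩
  have h := hf (e.symm x)
  rw [show f (e.symm x) = x from e.apply_symm_apply x] at h
  exact h.symm

lemma Ideal.exists_projection_right {I J K : Ideal R} (hdisj : I ⊓ J = ⊥) (hsum : I ⊔ J = K) :
    ∃ q : K →ₗ[R] J, ∀ (x : K) (hx : (x : R) ∈ J), q x = ⟨x, hx⟩ := by
  obtain ⟨p, q, h⟩ := Ideal.exists_projections hdisj hsum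
  refine ⟨q, fun x hx => Subtype.ext ?_⟩
  have hp : (p x : R) ∈ I ⊓ J := ⟨(p x).2, by
    rw [eq_sub_of_add_eq (h x)]; exact J.sub_mem hx (q x).2⟩
  rw [hdisj, Submodule.mem_bot] at hp
  simpa [hp] using h x

/-- A module with `I` and `J` as summands of its two factors has `I ⊕ J` as a summand. -/
lemma IsDirectSummand.of_ideal_decomposition {I J K : Ideal R} (hdisj : I ⊓ J = ⊥)
    (hsum : I ⊔ J = K) {A B : Type u} [AddCommGroup A] [Module R A] [AddCommGroup B] [Module R B]
    (hA : IsDirectSummand R I A) (hB : IsDirectSummand R J B) :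
    IsDirectSummand R K (A × B) := by
  obtain ⟨p, q, h⟩ := Ideal.exists_projections hdisj hsum
  obtain ⟨i, r, hir⟩ := hA
  obtain ⟨j, s, hjs⟩ := hB
  refine ⟨(i ∘ₗ p).prod (j ∘ₗ q),
    (Submodule.inclusion (le_sup_left.trans hsum.le) ∘ₗ r).coprod
      (Submodule.inclusion (le_sup_right.trans hsum.le) ∘ₗ s), LinearMap.ext fun x => ?_⟩
  apply Subtype.ext
  have h1 := LinearMap.congr_fun hir (p x)
  have h2 := LinearMap.congr_fun hjs (q x)
  simp only [LinearMap.comp_apply, LinearMap.id_apply] at h1 h2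
  simp [h1, h2, h]

lemma Ideal.smul_eq_zero_of_mem_smul_top_pi {I J : Ideal R} (hdisj : I ⊓ J = ⊥) {n : ℕ}
    {a : Fin n → R} (ha : a ∈ I • (⊤ : Submodule R (Fin n → R))) {j : R} (hj : j ∈ J) :
    j • a = 0 := by
  funext i
  have h : j * a i ∈ I ⊓ J :=
    ⟨I.mul_mem_left _ (Submodule.apply_mem_of_mem_smul_top_pi ha i), J.mul_mem_right _ hj⟩
  rw [hdisj] at h
  exact h

/-- The kernel of a map of free modules splits along a direct sum decomposition of an ideal. -/
lemma LinearMap.map_eq_zero_of_add_mem_ker {I J : Ideal R} (hdisj : I ⊓ J = ⊥) {n k : ℕ}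
    (f : (Fin n → R) →ₗ[R] (Fin k → R)) {a b : Fin n → R}
    (ha : a ∈ I • (⊤ : Submodule R (Fin n → R))) (hb : b ∈ J • (⊤ : Submodule R (Fin n → R)))
    (hab : a + b ∈ LinearMap.ker f) : f a = 0 := by
  rw [LinearMap.mem_ker, map_add] at hab
  funext i
  have hbi := Submodule.apply_mem_of_mem_smul_top_pi (Submodule.map_mem_smul_top f hb) i
  have h : f a i ∈ I ⊓ J :=
    ⟨Submodule.apply_mem_of_mem_smul_top_pi (Submodule.map_mem_smul_top f ha) i, by
      rw [eq_neg_of_add_eq_zero_left hab]; exact J.neg_mem hbi⟩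
  rw [hdisj] at h
  exact h

lemma Module.Projective.ker_of_ker {P Q M : Type*} [AddCommGroup P] [Module R P]
    [AddCommGroup Q] [Module R Q] [AddCommGroup M] [Module R M]
    [Module.Projective R P] [Module.Projective R Q] (f : P →ₗ[R] M) (g : Q →ₗ[R] M)
    (hf : Function.Surjective f) (hg : Function.Surjective g)
    [Module.Projective R (LinearMap.ker f)] : Module.Projective R (LinearMap.ker g) := by
  obtain ⟨s, hs⟩ := Module.projective_lifting_property g f hg
  obtain ⟨t, ht⟩ := Module.projective_lifting_property f g hf
  have hs' (x) : g (s x) = f x := LinearMap.congr_fun hs x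
  have ht' (x) : f (t x) = g x := LinearMap.congr_fun ht x
  let i : LinearMap.ker g →ₗ[R] LinearMap.ker f × Q :=
    ((t ∘ₗ (LinearMap.ker g).subtype).codRestrict _ fun x => by
      simp [ht']).prod (LinearMap.ker g).subtype
  let p : LinearMap.ker f × Q →ₗ[R] LinearMap.ker g :=
    ((s ∘ₗ (LinearMap.ker f).subtype).coprod (LinearMap.id - s ∘ₗ t)).codRestrict _ fun x => by
      simp [ht', hs']
  refine Module.Projective.of_split i p (LinearMap.ext fun x => Subtype.ext ?_)
  change s (t x) + ((x : Q) - s (t x)) = x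
  abel

variable [IsLocalRing R]

/-- If `e` is part of a basis and `J • e` lies in `K ≤ 𝔪 F`, then `J` is a summand of `K`. -/
lemma exists_splitting_of_smul_mem {I J : Ideal R} (hdisj : I ⊓ J = ⊥)
    (hsum : I ⊔ J = maximalIdeal R) {n : ℕ} {K : Submodule R (Fin n → R)}
    (hK : K ≤ maximalIdeal R • (⊤ : Submodule R (Fin n → R))) {e : Fin n → R}
    (he : e ∉ maximalIdeal R • (⊤ : Submodule R (Fin n → R)))
    (hJ : ∀ j ∈ J, j • e ∈ K) :
    ∃ (i : J →ₗ[R] K) (p : K →ₗ[R] J),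
      p ∘ₗ i = LinearMap.id ∧ ∀ j, (i j : Fin n → R) = (j : R) • e := by
  obtain ⟨c, hc⟩ : ∃ c, e c ∉ maximalIdeal R := by
    by_contra! h
    exact he (Submodule.mem_smul_top_pi_of_forall h)
  obtain ⟨u, hu⟩ : IsUnit (e c) := by simpa using hc
  obtain ⟨q, hq⟩ := Ideal.exists_projection_right hdisj hsum
  let coord : (Fin n → R) →ₗ[R] R := (↑u⁻¹ : R) • LinearMap.proj c
  have hcoord : coord e = 1 := by simp [coord, ← hu]
  have hmem (v : K) : (coord ∘ₗ K.subtype) v ∈ maximalIdeal R :=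
    Ideal.mul_mem_left _ _ (Submodule.apply_mem_of_mem_smul_top_pi (hK v.2) c)
  refine ⟨((LinearMap.toSpanSingleton R (Fin n → R) e) ∘ₗ J.subtype).codRestrict K
    (fun j => hJ j j.2), q ∘ₗ (coord ∘ₗ K.subtype).codRestrict _ hmem,
    LinearMap.ext fun j => ?_, fun j => rfl⟩
  have h1 : coord ((j : R) • e) = j := by rw [map_smul, hcoord]; simp
  refine (hq _ ?_).trans (Subtype.ext ?_)
  · exact (congrArg (· ∈ J) h1).mpr j.2
  · exact h1

lemma exists_mem_notMem_maximalIdeal_smul {A : Type*} [AddCommGroup A] [Module R A]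
    [IsNoetherian R A] {N : Submodule R A} (hN : N ≠ ⊥) :
    ∃ x ∈ N, x ∉ maximalIdeal R • N := by
  by_contra! h
  exact hN (Submodule.eq_bot_of_le_smul_of_le_jacobson_bot _ N (IsNoetherian.noetherian N) h
    (maximalIdeal_le_jacobson _))

/-- A minimal presentation of a projective module is injective. -/
lemma LinearMap.ker_eq_bot_of_projective_range {A B : Type*} [AddCommGroup A] [Module R A]
    [AddCommGroup B] [Module R B] [IsNoetherian R A] (f : A →ₗ[R] B)
    [Module.Projective R (LinearMap.range f)]
    (hf : LinearMap.ker f ≤ maximalIdeal R • (⊤ : Submodule R A)) : LinearMap.ker f = ⊥ := by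
  obtain ⟨s, hs⟩ := f.rangeRestrict.exists_rightInverse_of_surjective f.range_rangeRestrict
  have hs' (x) : f (s x) = x := congrArg Subtype.val (LinearMap.congr_fun hs x)
  let q : A →ₗ[R] A := LinearMap.id - s ∘ₗ f.rangeRestrict
  have hq (x : A) : q x ∈ LinearMap.ker f := by simp [q, hs']
  by_contra h
  obtain ⟨x, hx, hx'⟩ := exists_mem_notMem_maximalIdeal_smul h
  have hx0 : f.rangeRestrict x = 0 := Subtype.ext hx
  have hqx : q x = x := by simp [q, hx0]
  apply hx'
  rw [← hqx]
  have h1 := Submodule.mem_map_of_mem (f := q) (hf hx)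
  rw [Submodule.map_smul''] at h1
  refine Submodule.smul_mono le_rfl ?_ h1
  rintro _ ⟨y, -, rfl⟩
  exact hq y

variable [IsNoetherianRing R] {M : Type u} [AddCommGroup M] [Module R M]

/-- Nonvanishing of the second syzygy does not depend on the minimal free resolution. -/
lemma MinFreeRes.range_d_one_ne_bot (F G : MinFreeRes R (maximalIdeal R) M)
    (hF : LinearMap.range (F.d 1) ≠ ⊥) : LinearMap.range (G.d 1) ≠ ⊥ := by
  intro hG
  rw [G.exact 0, LinearMap.ker_eq_bot] at hG
  have hG' : Module.Projective R (LinearMap.ker G.aug) := by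
    rw [← G.exact_aug]
    exact Module.Projective.of_equiv (LinearEquiv.ofInjective (G.d 0) hG)
  have hF' : Module.Projective R (LinearMap.range (F.d 0)) := by
    rw [F.exact_aug]
    exact Module.Projective.ker_of_ker G.aug F.aug G.aug_surj F.aug_surj
  refine hF ?_
  rw [F.exact 0]
  exact LinearMap.ker_eq_bot_of_projective_range _ (F.exact 0 ▸ F.minimal 1)

/-- A minimal generator of the second syzygy lying in `I F₁` splits `J` off the third syzygy
and `I` off the fourth one. -/
lemma MinFreeRes.isDirectSummand_of_mem_smul_top {I J : Ideal R} (hJ : J ≠ ⊥)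
    (hdisj : I ⊓ J = ⊥) (hsum : I ⊔ J = maximalIdeal R) (F : MinFreeRes R (maximalIdeal R) M)
    {a : Fin (F.b 1) → R} (haI : a ∈ I • (⊤ : Submodule R (Fin (F.b 1) → R)))
    (ha : a ∈ LinearMap.range (F.d 1)) (ha' : a ∉ maximalIdeal R • LinearMap.range (F.d 1)) :
    IsDirectSummand R J (LinearMap.range (F.d 2)) ∧
      IsDirectSummand R I (LinearMap.range (F.d 3)) := by
  have hlift (n : ℕ) (e : Fin (F.b (n + 1)) → R)
      (he : F.d n e ∉ maximalIdeal R • LinearMap.range (F.d n)) :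
      e ∉ maximalIdeal R • (⊤ : Submodule R (Fin (F.b (n + 1)) → R)) := by
    contrapose! he
    have h := Submodule.mem_map_of_mem (f := F.d n) he
    rwa [Submodule.map_smul'', Submodule.map_top] at h
  obtain ⟨e, rfl⟩ := ha
  have hJe (j : R) (hj : j ∈ J) : j • e ∈ LinearMap.range (F.d 2) := by
    rw [F.exact 1, LinearMap.mem_ker, map_smul]
    exact Ideal.smul_eq_zero_of_mem_smul_top_pi hdisj haI hj
  obtain ⟨i, p, hip, hi⟩ :=
    exists_splitting_of_smul_mem hdisj hsum (F.minimal 2) (hlift 1 e ha') hJe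
  refine ⟨⟨i, p, hip⟩, ?_⟩
  obtain ⟨j, hj, hj'⟩ := exists_mem_notMem_maximalIdeal_smul hJ
  obtain ⟨e', he'⟩ := hJe j hj
  have hmin : F.d 2 e' ∉ maximalIdeal R • LinearMap.range (F.d 2) := by
    rw [he']
    intro h
    have h1 : i ⟨j, hj⟩ ∈ maximalIdeal R • (⊤ : Submodule R (LinearMap.range (F.d 2))) := by
      rw [Submodule.mem_smul_top_iff, hi]
      exact h
    have h2 := Submodule.map_mem_smul_top p h1
    rw [show p (i ⟨j, hj⟩) = ⟨j, hj⟩ from LinearMap.congr_fun hip _,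
      Submodule.mem_smul_top_iff] at h2
    exact hj' h2
  have hIe (r : R) (hr : r ∈ I) : r • e' ∈ LinearMap.range (F.d 3) := by
    have hrj : r * j ∈ I ⊓ J := ⟨I.mul_mem_right _ hr, J.mul_mem_left _ hj⟩
    rw [hdisj, Submodule.mem_bot] at hrj
    rw [F.exact 2, LinearMap.mem_ker, map_smul, he', smul_smul, hrj, zero_smul]
  obtain ⟨i', p', hip', -⟩ :=
    exists_splitting_of_smul_mem (inf_comm I J ▸ hdisj) (sup_comm I J ▸ hsum) (F.minimal 3)
      (hlift 2 e' hmin) hIe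
  exact ⟨i', p', hip'⟩

end DecomposableMaximalIdeal

/-- if `𝔪 = I ⊕ J` with `I, J` nonzero ideals and `M` has projective
dimension at least two, then `𝔪` is a direct summand of `Ω_R³(M) ⊕ Ω_R⁴(M)`. -/
theorem stmt9 (R : Type u) [CommRing R] [IsNoetherianRing R] [IsLocalRing R]
    (I J : Ideal R) (hI : I ≠ ⊥) (hJ : J ≠ ⊥)
    (hdisj : I ⊓ J = ⊥) (hsum : I ⊔ J = IsLocalRing.maximalIdeal R)
    (M : Type u) [AddCommGroup M] [Module R M] [Module.Finite R M]
    (hpd : ∃ F : MinFreeRes R (IsLocalRing.maximalIdeal R) M, Nontrivial (F.Syz 2)) :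
    ∀ F : MinFreeRes R (IsLocalRing.maximalIdeal R) M,
      IsDirectSummand R ↥(IsLocalRing.maximalIdeal R) (F.Syz 3 × F.Syz 4) := by
  intro F
  obtain ⟨G, hG⟩ := hpd
  have hG' : LinearMap.range (G.d 1) ≠ ⊥ :=
    (Submodule.nontrivial_iff_ne_bot (p := LinearMap.range (G.d 1))).1 hG
  obtain ⟨x, hx, hx'⟩ := exists_mem_notMem_maximalIdeal_smul (G.range_d_one_ne_bot F hG')
  have hm : IsLocalRing.maximalIdeal R • (⊤ : Submodule R (Fin (F.b 1) → R)) =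
      I • ⊤ ⊔ J • ⊤ :=
    (congrArg (· • ⊤) hsum.symm).trans (Submodule.sup_smul I J ⊤)
  obtain ⟨a, ha, b, hb, rfl⟩ := Submodule.mem_sup.1 (hm.le (F.minimal 1 hx))
  have hker := hx
  rw [F.exact 0] at hker
  have ha0 : a ∈ LinearMap.range (F.d 1) := by
    rw [F.exact 0]
    exact LinearMap.map_eq_zero_of_add_mem_ker hdisj _ ha hb hker
  have hb0 : b ∈ LinearMap.range (F.d 1) := (Submodule.add_mem_iff_right _ ha0).1 hx
  have hdisj' : J ⊓ I = ⊥ := inf_comm I J ▸ hdisj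
  have hsum' : J ⊔ I = IsLocalRing.maximalIdeal R := sup_comm I J ▸ hsum
  by_cases ha' : a ∈ IsLocalRing.maximalIdeal R • LinearMap.range (F.d 1)
  · have hb' : b ∉ IsLocalRing.maximalIdeal R • LinearMap.range (F.d 1) := fun hb' =>
      hx' (Submodule.add_mem _ ha' hb')
    obtain ⟨h3, h4⟩ := F.isDirectSummand_of_mem_smul_top hI hdisj' hsum' hb hb0 hb'
    exact IsDirectSummand.of_ideal_decomposition hdisj hsum h3 h4
  · obtain ⟨h3, h4⟩ := F.isDirectSummand_of_mem_smul_top hJ hdisj hsum ha ha0 ha'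
    exact IsDirectSummand.of_ideal_decomposition hdisj' hsum' h3 h4
end

section
/- Let (R, m) be a commutative noetherian local ring and M a finitely generated R-module. Then n := β₀^R(M) − β₁^R(Tr M) is a nonnegative integer and M ≅ Tr(Tr M) ⊕ R^n. -/
universe u

/-- A form of Nakayama's lemma: a map that is surjective after composing with a minimal
cover is surjective. -/
theorem LinearMap.surjective_of_comp_surjective_of_ker_le {R : Type*} [CommRing R] [IsLocalRing R]
    {P Q T : Type*} [AddCommGroup P] [Module R P] [Module.Finite R P]
    [AddCommGroup Q] [Module R Q] [AddCommGroup T] [Module R T]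
    (p : P →ₗ[R] T) (k : Q →ₗ[R] P)
    (hker : LinearMap.ker p ≤ IsLocalRing.maximalIdeal R • (⊤ : Submodule R P))
    (hsurj : LinearMap.range p ≤ LinearMap.range (p ∘ₗ k)) : Function.Surjective k := by
  rw [← LinearMap.range_eq_top, eq_top_iff]
  refine Submodule.le_of_le_smul_of_le_jacobson_bot (I := IsLocalRing.maximalIdeal R)
    Module.Finite.fg_top (IsLocalRing.maximalIdeal_le_jacobson _) fun x _ => ?_
  obtain ⟨y, hy⟩ := hsurj ⟨x, rfl⟩
  have hx : x - k y ∈ LinearMap.ker p := by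
    rw [LinearMap.mem_ker, map_sub, sub_eq_zero]
    exact hy.symm
  have : x = k y + (x - k y) := by abel
  rw [this]
  exact Submodule.add_mem_sup ⟨y, rfl⟩ (hker hx)

/-- The dual of a map of free modules with image in `I • ⊤` has image in `I • ⊤`. -/
theorem LinearMap.range_dualMap_le_smul_top {R : Type*} [CommRing R] (I : Ideal R)
    {Q ι : Type*} [AddCommGroup Q] [Module R Q] [Fintype ι] [DecidableEq ι]
    (f : (ι → R) →ₗ[R] Q) (hf : LinearMap.range f ≤ I • (⊤ : Submodule R Q)) :
    LinearMap.range f.dualMap ≤ I • (⊤ : Submodule R (Module.Dual R (ι → R))) := by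
  rintro _ ⟨φ, rfl⟩
  have hle : I • (⊤ : Submodule R Q) ≤ Submodule.comap φ I :=
    Submodule.smul_le.mpr fun r hr q _ => by simpa using I.mul_mem_right (φ q) hr
  have hmem (x : ι → R) : φ (f x) ∈ I := hle (hf ⟨x, rfl⟩)
  have hsum : f.dualMap φ = ∑ i, φ (f (Pi.single i 1)) • LinearMap.proj i := by
    refine LinearMap.pi_ext' fun i => LinearMap.ext_ring ?_
    simp [Pi.single_apply]
  rw [hsum]
  exact Submodule.sum_mem _ fun i _ => Submodule.smul_mem_smul (hmem _) trivial

/-- If `s ∘ i = id` and `p` is surjective with kernel the image of `L` under `i`, then the target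
of `p` is the direct sum of the quotient by `L` and the kernel of `s`. -/
theorem LinearMap.nonempty_equiv_quotient_prod_ker {R : Type*} [CommRing R]
    {Q N M : Type*} [AddCommGroup Q] [Module R Q] [AddCommGroup N] [Module R N]
    [AddCommGroup M] [Module R M] (i : N →ₗ[R] Q) (s : Q →ₗ[R] N)
    (hs : s ∘ₗ i = LinearMap.id) (L : Submodule R N) (p : Q →ₗ[R] M)
    (hp : Function.Surjective p) (hker : LinearMap.ker p = L.map i) :
    Nonempty (M ≃ₗ[R] (N ⧸ L) × LinearMap.ker s) := by
  have hsi (x : N) : s (i x) = x := LinearMap.congr_fun hs x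
  let q : Q →ₗ[R] LinearMap.ker s :=
    (LinearMap.id - i ∘ₗ s).codRestrict (LinearMap.ker s) fun x => by simp [hsi]
  let r : Q →ₗ[R] (N ⧸ L) × LinearMap.ker s := (L.mkQ ∘ₗ s).prod q
  have hr : Function.Surjective r := by
    rintro ⟨a, b, hb⟩
    obtain ⟨a, rfl⟩ := L.mkQ_surjective a
    rw [LinearMap.mem_ker] at hb
    refine ⟨i a + b, Prod.ext ?_ (Subtype.ext ?_)⟩
    · simp [r, hsi, hb]
    · simp [r, q, hsi, hb]
  have hrk : LinearMap.ker p = LinearMap.ker r := by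
    rw [hker]
    ext x
    have hx : x ∈ LinearMap.ker r ↔ s x ∈ L ∧ x - i (s x) = 0 := by
      simp [r, q]
    rw [hx, Submodule.mem_map]
    constructor
    · rintro ⟨y, hy, rfl⟩
      simpa [hsi] using hy
    · rintro ⟨h, h'⟩
      exact ⟨s x, h, (sub_eq_zero.mp h').symm⟩
  exact ⟨(p.quotKerEquivOfSurjective hp).symm ≪≫ₗ Submodule.quotEquivOfEq _ _ hrk ≪≫ₗ
    r.quotKerEquivOfSurjective hr⟩

/-- Over a local ring, the kernel of a split epimorphism of finite free modules is free of rank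
the difference of the ranks. -/
theorem LinearMap.nonempty_ker_equiv_fin {R : Type*} [CommRing R] [IsLocalRing R]
    {Q N : Type*} [AddCommGroup Q] [Module R Q] [Module.Free R Q] [Module.Finite R Q]
    [AddCommGroup N] [Module R N] [Module.Free R N] [Module.Finite R N]
    (i : N →ₗ[R] Q) (s : Q →ₗ[R] N) (hs : s ∘ₗ i = LinearMap.id) :
    Module.finrank R N ≤ Module.finrank R Q ∧
      Nonempty (LinearMap.ker s ≃ₗ[R]
        (Fin (Module.finrank R Q - Module.finrank R N) → R)) := by
  obtain ⟨e₀⟩ := LinearMap.nonempty_equiv_quotient_prod_ker i s hs ⊥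
    (LinearMap.id : Q →ₗ[R] Q) Function.surjective_id (by simp)
  let e : Q ≃ₗ[R] N × LinearMap.ker s :=
    e₀ ≪≫ₗ (Submodule.quotEquivOfEqBot (⊥ : Submodule R N) rfl).prodCongr (LinearEquiv.refl R (LinearMap.ker s))
  have hfin : Module.Finite R (LinearMap.ker s) :=
    Module.Finite.of_surjective (LinearMap.snd R N (LinearMap.ker s) ∘ₗ e.toLinearMap)
      (Prod.snd_surjective.comp e.surjective)
  have hproj : Module.Projective R (LinearMap.ker s) :=
    Module.Projective.of_split (e.symm.toLinearMap ∘ₗ LinearMap.inr R N (LinearMap.ker s))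
      (LinearMap.snd R N (LinearMap.ker s) ∘ₗ e.toLinearMap) (by ext; simp)
  have hfree : Module.Free R (LinearMap.ker s) := Module.free_of_flat_of_isLocalRing
  have hrank := e.finrank_eq
  rw [Module.finrank_prod] at hrank
  refine ⟨by omega, ⟨LinearEquiv.ofFinrankEq _ _ ?_⟩⟩
  rw [Module.finrank_fin_fun]
  omega

namespace MinFreeRes

/-- The degree-zero part of a minimal free resolution of `F.Tr` is the dual of the degree-one
part of `F`, compatibly with the augmentations. -/
theorem exists_dual_equiv {R : Type u} [CommRing R] [IsLocalRing R]
    {M : Type u} [AddCommGroup M] [Module R M]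
    (F : MinFreeRes R (IsLocalRing.maximalIdeal R) M)
    (G : MinFreeRes R (IsLocalRing.maximalIdeal R) F.Tr) :
    ∃ e : Module.Dual R (Fin (F.b 1) → R) ≃ₗ[R] (Fin (G.b 0) → R),
      ∀ φ, G.aug (e φ) = (LinearMap.range (F.d 0).dualMap).mkQ φ := by
  let π : Module.Dual R (Fin (F.b 1) → R) →ₗ[R] F.Tr := (LinearMap.range (F.d 0).dualMap).mkQ
  have hπ : Function.Surjective π := Submodule.mkQ_surjective _
  have hkerπ : LinearMap.ker π = LinearMap.range (F.d 0).dualMap := Submodule.ker_mkQ _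
  obtain ⟨α, hα⟩ := Module.projective_lifting_property G.aug π G.aug_surj
  obtain ⟨β, hβ⟩ := Module.projective_lifting_property π G.aug hπ
  have hαs : Function.Surjective α :=
    LinearMap.surjective_of_comp_surjective_of_ker_le G.aug α
      (G.exact_aug ▸ G.minimal 0)
      (by rw [hα, LinearMap.range_eq_top.mpr hπ]; exact le_top)
  have hβs : Function.Surjective β :=
    LinearMap.surjective_of_comp_surjective_of_ker_le π β
      (hkerπ ▸ LinearMap.range_dualMap_le_smul_top _ _ (F.minimal 0))
      (by rw [hβ, LinearMap.range_eq_top.mpr G.aug_surj]; exact le_top)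
  have hinj : Function.Injective (β ∘ₗ α) :=
    OrzechProperty.injective_of_surjective_endomorphism _ (hβs.comp hαs)
  exact ⟨LinearEquiv.ofBijective α ⟨Function.Injective.of_comp (f := β) hinj, hαs⟩,
    fun φ => LinearMap.congr_fun hα φ⟩

/-- The dual of the degree-zero part of `F` maps onto the degree-one part of a minimal free
resolution of `F.Tr`, compatibly with the differentials. -/
theorem exists_dual_surjective {R : Type u} [CommRing R] [IsLocalRing R]
    {M : Type u} [AddCommGroup M] [Module R M]
    (F : MinFreeRes R (IsLocalRing.maximalIdeal R) M)
    (G : MinFreeRes R (IsLocalRing.maximalIdeal R) F.Tr) :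
    ∃ (e : Module.Dual R (Fin (F.b 1) → R) ≃ₗ[R] (Fin (G.b 0) → R))
      (h : Module.Dual R (Fin (F.b 0) → R) →ₗ[R] (Fin (G.b 1) → R)),
      Function.Surjective h ∧ G.d 0 ∘ₗ h = e.toLinearMap ∘ₗ (F.d 0).dualMap := by
  obtain ⟨e, he⟩ := exists_dual_equiv F G
  have hrange : LinearMap.range (G.d 0) =
      LinearMap.range (e.toLinearMap ∘ₗ (F.d 0).dualMap) := by
    rw [G.exact_aug, LinearMap.range_comp]
    ext x
    obtain ⟨φ, rfl⟩ := e.surjective x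
    rw [LinearMap.mem_ker, he]
    refine (Submodule.Quotient.mk_eq_zero _).trans ?_
    simp
  let k := (e.toLinearMap ∘ₗ (F.d 0).dualMap).codRestrict (LinearMap.range (G.d 0))
    fun x => hrange ▸ LinearMap.mem_range_self _ x
  obtain ⟨h, hh⟩ := Module.projective_lifting_property (G.d 0).rangeRestrict k
    (G.d 0).surjective_rangeRestrict
  have hcomp : G.d 0 ∘ₗ h = e.toLinearMap ∘ₗ (F.d 0).dualMap :=
    LinearMap.ext fun x => congrArg Subtype.val (LinearMap.congr_fun hh x)
  refine ⟨e, h, LinearMap.surjective_of_comp_surjective_of_ker_le (G.d 0) h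
    (G.exact 0 ▸ G.minimal 1) ?_, hcomp⟩
  rw [hcomp, hrange]

end MinFreeRes

/-- `n := β₀(M) − β₁(Tr M)` is nonnegative and `M ≅ Tr(Tr M) ⊕ Rⁿ`. -/
theorem stmt11 (R : Type u) [CommRing R] [IsNoetherianRing R] [IsLocalRing R]
    (M : Type u) [AddCommGroup M] [Module R M] [Module.Finite R M] :
    ∀ (F : MinFreeRes R (IsLocalRing.maximalIdeal R) M)
      (G : MinFreeRes R (IsLocalRing.maximalIdeal R) F.Tr),
      G.b 1 ≤ F.b 0 ∧
      Nonempty (M ≃ₗ[R] G.Tr × (Fin (F.b 0 - G.b 1) → R)) := by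
  intro F G
  obtain ⟨e, h, hsurj, hcomp⟩ := MinFreeRes.exists_dual_surjective F G
  obtain ⟨t, ht⟩ := Module.projective_lifting_property h LinearMap.id hsurj
  let ev := Module.evalEquiv R (Fin (F.b 0) → R)
  let i : Module.Dual R (Fin (G.b 1) → R) →ₗ[R] (Fin (F.b 0) → R) :=
    ev.symm.toLinearMap ∘ₗ h.dualMap
  let s : (Fin (F.b 0) → R) →ₗ[R] Module.Dual R (Fin (G.b 1) → R) :=
    t.dualMap ∘ₗ ev.toLinearMap
  have hs : s ∘ₗ i = LinearMap.id := by
    ext1 φ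
    have : t.dualMap (h.dualMap φ) = φ :=
      LinearMap.ext fun x => congrArg φ (LinearMap.congr_fun ht x)
    simpa [s, i] using this
  have hev (x : Fin (F.b 1) → R) :
      ev (F.d 0 x) = h.dualMap ((G.d 0).dualMap
        (e.symm.toLinearMap.dualMap (Module.evalEquiv R _ x))) := by
    ext1 φ
    have := LinearMap.congr_fun hcomp φ
    simp only [LinearMap.comp_apply, LinearEquiv.coe_coe] at this
    simp [ev, this]
  have hker : LinearMap.ker F.aug = (LinearMap.range (G.d 0).dualMap).map i := by
    rw [← F.exact_aug]
    apply le_antisymm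
    · rintro _ ⟨x, rfl⟩
      exact ⟨_, ⟨_, rfl⟩, ev.symm_apply_eq.mpr (hev x).symm⟩
    · rintro _ ⟨_, ⟨ψ, rfl⟩, rfl⟩
      refine ⟨(Module.evalEquiv R _).symm (e.toLinearMap.dualMap ψ), ?_⟩
      refine ((ev.symm_apply_eq).mpr ?_).symm
      rw [hev, LinearEquiv.apply_symm_apply]
      have : e.symm.toLinearMap.dualMap (e.toLinearMap.dualMap ψ) = ψ :=
        LinearMap.ext fun y => congrArg ψ (e.apply_symm_apply y)
      rw [this]
  obtain ⟨e₁⟩ := LinearMap.nonempty_equiv_quotient_prod_ker i s hs _ F.aug F.aug_surj hker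
  have hfree := LinearMap.nonempty_ker_equiv_fin i s hs
  rw [show Module.finrank R (Module.Dual R (Fin (G.b 1) → R)) = G.b 1 by
    simp [Module.finrank_linearMap], Module.finrank_fin_fun] at hfree
  obtain ⟨hle, ⟨e₂⟩⟩ := hfree
  exact ⟨hle, ⟨e₁ ≪≫ₗ (LinearEquiv.refl R G.Tr).prodCongr e₂⟩⟩
end

section
/- Let (R, m, k) be a commutative noetherian local ring of depth t and let n be an integer with 0 ≤ n ≤ t. Then the n-th syzygy Ωⁿ(k) of the residue field has depth exactly n. -/
universe u

open CategoryTheory Abelian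

namespace MinFreeRes

variable {R : Type u} [CommRing R] {𝔪 : Ideal R} {M : Type u} [AddCommGroup M] [Module R M]

theorem existsSES_syz (F : MinFreeRes R 𝔪 M) :
    ∀ n, ExistsSES R (F.Syz (n + 1)) (Fin (F.b n) → R) (F.Syz n)
  | 0 => ⟨(LinearMap.range (F.d 0)).subtype, F.aug, Subtype.val_injective, F.aug_surj,
      (Submodule.range_subtype _).trans F.exact_aug⟩
  | n + 1 => ⟨(LinearMap.range (F.d (n + 1))).subtype, (F.d n).rangeRestrict,
      Subtype.val_injective, (F.d n).surjective_rangeRestrict,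
      (Submodule.range_subtype _).trans <| (F.exact n).trans (F.d n).ker_rangeRestrict.symm⟩

theorem finite_syz [Module.Finite R M] (F : MinFreeRes R 𝔪 M) : ∀ n, Module.Finite R (F.Syz n)
  | 0 => inferInstanceAs (Module.Finite R M)
  | n + 1 => inferInstanceAs (Module.Finite R (LinearMap.range (F.d n)))

end MinFreeRes

theorem ExistsSES.exists_shortExact {R : Type u} [CommRing R] {A B C : Type u}
    [AddCommGroup A] [Module R A] [AddCommGroup B] [Module R B] [AddCommGroup C] [Module R C]
    (h : ExistsSES R A B C) :
    ∃ (f : ModuleCat.of R A ⟶ ModuleCat.of R B) (g : ModuleCat.of R B ⟶ ModuleCat.of R C)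
      (w : f ≫ g = 0), (ShortComplex.mk f g w).ShortExact := by
  obtain ⟨i, p, hi, hp, hip⟩ := h
  have hex : Function.Exact i p := LinearMap.exact_iff.mpr hip.symm
  refine ⟨ModuleCat.ofHom i, ModuleCat.ofHom p, ?_, ?_⟩
  · ext x
    exact hex.apply_apply_eq_zero x
  · exact { exact := ModuleCat.shortComplex_exact _ hex
            mono_f := (ModuleCat.mono_iff_injective _).mpr hi
            epi_g := (ModuleCat.epi_iff_surjective _).mpr hp }

theorem ModuleCat.subsingleton_ext_of_subsingleton {R : Type u} [CommRing R] (N M : ModuleCat.{u} R)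
    [Subsingleton M] (i : ℕ) :
    Subsingleton (Ext N M i) :=
  ⟨fun x y ↦ by
    have hM : Limits.IsZero M := ModuleCat.isZero_of_subsingleton M
    rw [← x.comp_mk₀_id, ← y.comp_mk₀_id, hM.eq_of_src (𝟙 M) 0]
    simp⟩

namespace IsLocalRing

variable (R : Type u) [CommRing R] [IsLocalRing R]

theorem support_residueField :
    Module.support R (ResidueField R) = PrimeSpectrum.zeroLocus (maximalIdeal R) := by
  change Module.support R (R ⧸ maximalIdeal R) = _
  rw [Module.support_eq_zeroLocus, Ideal.annihilator_quotient]

variable {R}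

theorem maximalIdeal_smul_top_lt_top (M : Type u) [AddCommGroup M] [Module R M]
    [Module.Finite R M] [Nontrivial M] :
    maximalIdeal R • (⊤ : Submodule R M) < ⊤ :=
  (Submodule.top_ne_ideal_smul_of_le_jacobson_annihilator
    (maximalIdeal_le_jacobson _)).symm.lt_top

variable [IsNoetherianRing R]

theorem subsingleton_ext_residueField_of_isWeaklyRegular (M : Type u) [AddCommGroup M] [Module R M]
    [Module.Finite R M] {rs : List R} (mem : ∀ x ∈ rs, x ∈ maximalIdeal R)
    (reg : RingTheory.Sequence.IsWeaklyRegular M rs) {i : ℕ} (hi : i < rs.length) :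
    Subsingleton (Ext (ModuleCat.of R (ResidueField R)) (ModuleCat.of R M) i) := by
  cases subsingleton_or_nontrivial M
  · exact ModuleCat.subsingleton_ext_of_subsingleton _ (ModuleCat.of R M) i
  · exact ModuleCat.subsingleton_ext_of_exists_isRegular (maximalIdeal R)
      (ModuleCat.of R (ResidueField R)) (support_residueField R).subset (ModuleCat.of R M)
      (maximalIdeal_smul_top_lt_top M) rs mem
      ((isRegular_iff_isWeaklyRegular_of_subset_maximalIdeal mem).mpr reg) i hi

theorem hasDepth_of_ext (M : Type u) [AddCommGroup M] [Module R M] [Module.Finite R M] (n : ℕ)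
    (h_lt : ∀ i < n,
      Subsingleton (Ext (ModuleCat.of R (ResidueField R)) (ModuleCat.of R M) i))
    (h_eq : Nontrivial (Ext (ModuleCat.of R (ResidueField R)) (ModuleCat.of R M) n)) :
    HasDepth R (maximalIdeal R) M n := by
  have : Nontrivial M := by
    by_contra h
    have : Subsingleton (ModuleCat.of R M) := not_nontrivial_iff_subsingleton.mp h
    exact not_subsingleton _ (ModuleCat.subsingleton_ext_of_subsingleton
      (ModuleCat.of R (ResidueField R)) (ModuleCat.of R M) n)
  refine ⟨ModuleCat.exists_isRegular_of_exists_subsingleton_ext (maximalIdeal R) n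
    (ModuleCat.of R M) (maximalIdeal_smul_top_lt_top M) (ModuleCat.of R (ResidueField R))
    (support_residueField R) h_lt, fun rs mem reg ↦ ?_⟩
  by_contra! hlen
  exact not_subsingleton _
    (subsingleton_ext_residueField_of_isWeaklyRegular M mem reg.toIsWeaklyRegular hlen)

theorem subsingleton_ext_residueField_of_flat {t : ℕ} (ht : HasDepth R (maximalIdeal R) R t)
    (M : Type u) [AddCommGroup M] [Module R M] [Module.Finite R M] [Module.Flat R M]
    {i : ℕ} (hi : i < t) :
    Subsingleton (Ext (ModuleCat.of R (ResidueField R)) (ModuleCat.of R M) i) := by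
  obtain ⟨rs, rfl, mem, reg⟩ := ht.1
  exact subsingleton_ext_residueField_of_isWeaklyRegular M mem
    (((TensorProduct.rid R M).isWeaklyRegular_congr rs).mp
      reg.toIsWeaklyRegular.isWeaklyRegular_lTensor) hi

theorem ext_syz_residueField {t : ℕ} (ht : HasDepth R (maximalIdeal R) R t)
    (F : MinFreeRes R (maximalIdeal R) (ResidueField R)) (n : ℕ) (hn : n ≤ t) :
    (∀ i < n, Subsingleton
      (Ext (ModuleCat.of R (ResidueField R)) (ModuleCat.of R (F.Syz n)) i)) ∧
    Nontrivial (Ext (ModuleCat.of R (ResidueField R)) (ModuleCat.of R (F.Syz n)) n) := by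
  induction n with
  | zero =>
    have : Nontrivial (ResidueField R →ₗ[R] ResidueField R) :=
      inferInstanceAs (Nontrivial (Module.End R (ResidueField R)))
    exact ⟨by simp, (Ext.addEquiv₀.trans (ModuleCat.homAddEquiv (M := .of R (ResidueField R))
      (N := .of R (ResidueField R)))).toEquiv.nontrivial⟩
  | succ n ih =>
    obtain ⟨h_lt, h_eq⟩ := ih (by lia)
    obtain ⟨f, g, w, hS⟩ := (F.existsSES_syz n).exists_shortExact
    have free {i : ℕ} (hi : i < t) := subsingleton_ext_residueField_of_flat ht (Fin (F.b n) → R) hi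
    constructor
    · rintro (_ | i) hi
      · have := hS.mono_f
        have := free (i := 0) (by lia)
        exact (Ext.postcomp_mk₀_injective_of_mono _ f).subsingleton
      · have := free (i := i + 1) (by lia)
        have := h_lt i (by lia)
        refine subsingleton_of_forall_eq 0 fun x ↦ ?_
        obtain ⟨y, rfl⟩ := Ext.covariant_sequence_exact₁ _ hS x (Subsingleton.elim _ _) rfl
        rw [Subsingleton.elim y 0, Ext.zero_comp]
    · have := free (i := n) (by lia)
      refine Function.Injective.nontrivial
        (f := hS.extClass.postcomp (ModuleCat.of R (ResidueField R)) rfl)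
        ((injective_iff_map_eq_zero _).mpr fun x hx ↦ ?_)
      obtain ⟨y, rfl⟩ := Ext.covariant_sequence_exact₃ _ hS x rfl hx
      rw [Subsingleton.elim y 0, Ext.zero_comp]

end IsLocalRing

/-- if `R` has depth `t` and `0 ≤ n ≤ t`, then the `n`-th syzygy
`Ωⁿ(k)` of the residue field has depth exactly `n`. -/
theorem stmt12 (R : Type u) [CommRing R] [IsNoetherianRing R] [IsLocalRing R]
    (t : ℕ) (ht : HasDepth R (IsLocalRing.maximalIdeal R) R t)
    (n : ℕ) (hn : n ≤ t) :
    ∀ F : MinFreeRes R (IsLocalRing.maximalIdeal R) (IsLocalRing.ResidueField R),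
      HasDepth R (IsLocalRing.maximalIdeal R) (F.Syz n) n := by
  intro F
  have := F.finite_syz n
  obtain ⟨h_lt, h_eq⟩ := IsLocalRing.ext_syz_residueField ht F n hn
  exact IsLocalRing.hasDepth_of_ext (F.Syz n) n h_lt h_eq
end
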